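/- arXiv:2503.00662 — 5 statements merged into one kernel-verified Lean document; each statement's English description precedes it below -/
import Mathlib

section
/- Let S ⊆ ℤ. The following are equivalent: (i) A_S^n is strongly transitive for every integer n > 0; (ii) A_S^n is strongly transitive for at least one integer n ≥ 3; (iii) for all integers s,t ∉ S: if st ≥ 0 then s+t ∉ S, and if st ≤ 0 then s−t ∉ S and t−s ∉ S. -/
namespace Braid

/-- The hyperplane `{x ∈ ℝ^n | x i - x j = s}`. -/
def hyp (n : ℕ) (i j : Fin n) (s : ℝ) : Set (Fin n → ℝ) := {x | x i - x j = s}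

/-- The arrangement `A_S^n`, as a set of hyperplanes. -/
def arrS (S : Set ℤ) (n : ℕ) : Set (Set (Fin n → ℝ)) :=
  {H | ∃ i j : Fin n, ∃ s : ℤ, i < j ∧ s ∈ S ∧ H = hyp n i j (s : ℝ)}

/-- A strongly transitive arrangement. -/
def IsStronglyTransitive (n : ℕ) (A : Set (Set (Fin n → ℝ))) : Prop :=
  ∀ i j k : Fin n, i ≠ j → j ≠ k → i ≠ k → ∀ s t : ℕ,
    hyp n i j (s : ℝ) ∉ A → hyp n j k (t : ℝ) ∉ A → hyp n i k ((s : ℝ) + (t : ℝ)) ∉ A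

theorem hyp_eq_aux (n : ℕ) (i j a b : Fin n) (s t : ℝ) (hij : i ≠ j) (hab : a ≠ b)
    (h : hyp n i j s = hyp n a b t) : (i = a ∧ j = b ∧ s = t) ∨ (i = b ∧ j = a ∧ s = -t) := by
  have key : ∀ x : Fin n → ℝ, x i - x j = s ↔ x a - x b = t := fun x => Set.ext_iff.1 h x
  have h0 := (key (fun m => if m = i then s else 0)).1 (by simp [hij.symm])
  have ha : a = i ∨ a = j := by
    by_contra hc
    push Not at hc
    have h1 := (key (fun m => if m = i then s else if m = a then 1 else 0)).1
      (by simp [hij.symm, hc.2.symm])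
    simp only [hc.1, if_false, if_true, hab.symm] at h0 h1
    split_ifs at h0 h1 <;> linarith
  have hb : b = i ∨ b = j := by
    by_contra hc
    push Not at hc
    have h1 := (key (fun m => if m = i then s else if m = b then 1 else 0)).1
      (by simp [hij.symm, hc.2.symm])
    simp only [hc.1, if_false, if_true, hab] at h0 h1
    split_ifs at h0 h1 <;> linarith
  rcases ha with rfl | rfl <;> rcases hb with rfl | rfl
  · exact absurd rfl hab
  · left
    simp [hij.symm] at h0
    exact ⟨rfl, rfl, h0⟩
  · right
    simp [hij.symm] at h0
    exact ⟨rfl, rfl, by linarith⟩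
  · exact absurd rfl hab

theorem mem_arrS_iff (S : Set ℤ) (n : ℕ) (i j : Fin n) (hij : i ≠ j) (s : ℤ) (r : ℝ)
    (hr : r = (s : ℝ)) :
    hyp n i j r ∈ arrS S n ↔ (i < j ∧ s ∈ S) ∨ (j < i ∧ -s ∈ S) := by
  subst hr
  constructor
  · rintro ⟨a, b, t, hab, ht, h⟩
    rcases hyp_eq_aux n i j a b s t hij hab.ne h with ⟨rfl, rfl, hh⟩ | ⟨rfl, rfl, hh⟩
    · left
      have : s = t := by exact_mod_cast hh
      exact ⟨hab, this ▸ ht⟩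
    · right
      have : s = -t := by exact_mod_cast hh
      refine ⟨hab, ?_⟩
      rw [this, neg_neg]
      exact ht
  · rintro (⟨h, hs⟩ | ⟨h, hs⟩)
    · exact ⟨i, j, s, h, hs, rfl⟩
    · refine ⟨j, i, -s, h, hs, ?_⟩
      ext x
      simp only [hyp, Set.mem_ofPred_eq, Int.cast_neg]
      constructor <;> intro h <;> linarith

theorem st_iff (S : Set ℤ) (n : ℕ) : IsStronglyTransitive n (arrS S n) ↔
    ∀ i j k : Fin n, i ≠ j → j ≠ k → i ≠ k → ∀ s t : ℕ,
      ¬ ((i < j ∧ (s : ℤ) ∈ S) ∨ (j < i ∧ -(s : ℤ) ∈ S)) →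
      ¬ ((j < k ∧ (t : ℤ) ∈ S) ∨ (k < j ∧ -(t : ℤ) ∈ S)) →
      ¬ ((i < k ∧ ((s : ℤ) + t) ∈ S) ∨ (k < i ∧ -((s : ℤ) + t) ∈ S)) := by
  unfold IsStronglyTransitive
  refine forall_congr' fun i => forall_congr' fun j => forall_congr' fun k =>
    forall_congr' fun hij => forall_congr' fun hjk => forall_congr' fun hik =>
    forall_congr' fun s => forall_congr' fun t => ?_
  rw [mem_arrS_iff S n i j hij s _ (by simp), mem_arrS_iff S n j k hjk t _ (by simp),
    mem_arrS_iff S n i k hik ((s : ℤ) + t) _ (by simp)]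

theorem three_one (S : Set ℤ)
    (H : ∀ s t : ℤ, s ∉ S → t ∉ S →
        (0 ≤ s * t → s + t ∉ S) ∧ (s * t ≤ 0 → s - t ∉ S ∧ t - s ∉ S)) (n : ℕ) :
    IsStronglyTransitive n (arrS S n) := by
  rw [st_iff]
  intro i j k hij hjk hik s t h1 h2
  have hst : (0 : ℤ) ≤ (s : ℤ) * t := by positivity
  have e1 : -((s : ℤ) + t) = -s + -t := by ring
  have e2 : -((s : ℤ) + t) = -s - t := by ring
  have e3 : -((s : ℤ) + t) = -t - s := by ring
  have e4 : (s : ℤ) + t = s - -t := by ring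
  have e5 : (s : ℤ) + t = t - -s := by ring
  have A : (s : ℤ) ∉ S → (t : ℤ) ∉ S → (s : ℤ) + t ∉ S := fun a b => (H _ _ a b).1 hst
  have B : -(s : ℤ) ∉ S → -(t : ℤ) ∉ S → -((s : ℤ) + t) ∉ S := fun a b =>
    e1 ▸ (H _ _ a b).1 (by linarith [neg_mul_neg (s : ℤ) t])
  have C : (s : ℤ) ∉ S → -(t : ℤ) ∉ S → (s : ℤ) + t ∉ S ∧ -((s : ℤ) + t) ∉ S := fun a b => by
    have := (H _ _ a b).2 (by linarith [mul_neg (s : ℤ) t])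
    exact ⟨e4 ▸ this.1, e3 ▸ this.2⟩
  have D : -(s : ℤ) ∉ S → (t : ℤ) ∉ S → (s : ℤ) + t ∉ S ∧ -((s : ℤ) + t) ∉ S := fun a b => by
    have := (H _ _ a b).2 (by linarith [neg_mul (s : ℤ) t])
    exact ⟨e5 ▸ this.2, e2 ▸ this.1⟩
  rcases lt_or_gt_of_ne hij with h | h <;> rcases lt_or_gt_of_ne hjk with h' | h' <;>
    simp only [h, h', h.not_gt, h'.not_gt, true_and, false_and, or_false, false_or] at h1 h2
  · have := h.trans h'
    rintro (⟨-, h3⟩ | ⟨h3, -⟩)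
    · exact A h1 h2 h3
    · exact this.not_gt h3
  · have := C h1 h2
    tauto
  · have := D h1 h2
    tauto
  · have := B h1 h2
    have := h'.trans h
    rintro (⟨h3, -⟩ | ⟨-, h3⟩)
    · exact this.not_gt h3
    · exact B h1 h2 h3

theorem two_three (S : Set ℤ) (n : ℕ) (hn : 3 ≤ n) (H : IsStronglyTransitive n (arrS S n)) :
    ∀ s t : ℤ, s ∉ S → t ∉ S →
        (0 ≤ s * t → s + t ∉ S) ∧ (s * t ≤ 0 → s - t ∉ S ∧ t - s ∉ S) := by
  rw [st_iff] at H
  let a : Fin n := ⟨0, by omega⟩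
  let b : Fin n := ⟨1, by omega⟩
  let c : Fin n := ⟨2, by omega⟩
  have hab : a < b := by simp [a, b]
  have hbc : b < c := by simp [b, c]
  have hac : a < c := hab.trans hbc
  have A := H a b c hab.ne hbc.ne hac.ne
  have B := H c b a hbc.ne' hab.ne' hac.ne'
  have C1 := H a c b hac.ne hbc.ne' hab.ne
  have C2 := H b c a hbc.ne hac.ne' hab.ne'
  simp only [hab, hbc, hac, hab.not_gt, hbc.not_gt, hac.not_gt, true_and, false_and, or_false,
    false_or] at A B C1 C2
  have D : ∀ s t : ℤ, 0 ≤ s → t ≤ 0 → s ∉ S → t ∉ S → s - t ∉ S ∧ t - s ∉ S := by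
    intro s t hs ht h1 h2
    obtain ⟨p, rfl⟩ := Int.eq_ofNat_of_zero_le hs
    obtain ⟨q, hq⟩ := Int.eq_ofNat_of_zero_le (neg_nonneg.2 ht)
    obtain rfl : t = -q := by omega
    have e1 : (p : ℤ) - -q = p + q := by ring
    have e2 : -(q : ℤ) - p = -(p + q) := by ring
    rw [e1, e2]
    exact ⟨C1 p q h1 h2, C2 p q h1 h2⟩
  intro s t h1 h2
  constructor
  · intro h
    rcases mul_nonneg_iff.1 h with ⟨hs, ht⟩ | ⟨hs, ht⟩
    · obtain ⟨p, rfl⟩ := Int.eq_ofNat_of_zero_le hs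
      obtain ⟨q, rfl⟩ := Int.eq_ofNat_of_zero_le ht
      exact A p q h1 h2
    · obtain ⟨p, hp⟩ := Int.eq_ofNat_of_zero_le (neg_nonneg.2 hs)
      obtain ⟨q, hq⟩ := Int.eq_ofNat_of_zero_le (neg_nonneg.2 ht)
      obtain rfl : s = -p := by omega
      obtain rfl : t = -q := by omega
      have e : -(p : ℤ) + -q = -(p + q) := by ring
      rw [e]
      exact B p q h1 h2
  · intro h
    rcases mul_nonpos_iff.1 h with ⟨hs, ht⟩ | ⟨hs, ht⟩
    · exact D s t hs ht h1 h2
    · exact (D t s ht hs h2 h1).symm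

/-- Lemma 3.6. For `S ⊆ ℤ`, the following are equivalent:
(i) `A_S^n` is strongly transitive for every `n > 0`;
(ii) `A_S^n` is strongly transitive for some `n ≥ 3`;
(iii) for all `s,t ∉ S`: if `st ≥ 0` then `s+t ∉ S`, and if `st ≤ 0` then `s-t, t-s ∉ S`. -/
theorem strongly_transitive_sets (S : Set ℤ) :
    ((∀ n : ℕ, 0 < n → IsStronglyTransitive n (arrS S n)) ↔
      (∃ n : ℕ, 3 ≤ n ∧ IsStronglyTransitive n (arrS S n))) ∧
    ((∃ n : ℕ, 3 ≤ n ∧ IsStronglyTransitive n (arrS S n)) ↔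
      (∀ s t : ℤ, s ∉ S → t ∉ S →
        (0 ≤ s * t → s + t ∉ S) ∧ (s * t ≤ 0 → s - t ∉ S ∧ t - s ∉ S))) := by
  refine ⟨⟨fun h => ⟨3, le_rfl, h 3 (by norm_num)⟩, ?_⟩, ?_, fun h => ⟨3, le_rfl, three_one S h 3⟩⟩
  · rintro ⟨n, hn, h⟩ m -
    exact three_one S (two_three S n hn h) m
  · rintro ⟨n, hn, h⟩
    exact two_three S n hn h

end Braid
end

section
/- Let n ≥ 3. A braid-type arrangement A in ℝ^n is symmetric and strongly transitive if and only if A = A_S^n for some set S ⊆ ℤ satisfying S = −S and such that for all s,t ∈ ℕ ∖ S one has s+t ∉ S. -/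
namespace Braid

/-- A braid-type arrangement: a finite set of hyperplanes, each of the form
`{x_i - x_j = s}` with `i ≠ j` and `s ∈ ℤ`. -/
def IsBraidType (n : ℕ) (A : Set (Set (Fin n → ℝ))) : Prop :=
  A.Finite ∧ ∀ H ∈ A, ∃ (i j : Fin n) (s : ℤ), i ≠ j ∧ H = hyp n i j (s : ℝ)

/-- `A` is symmetric: `π(A) = A` for every permutation `π` of the coordinates,
where `(π·x) k = x (π⁻¹ k)`. -/
def IsSymmetricArr (n : ℕ) (A : Set (Set (Fin n → ℝ))) : Prop :=
  ∀ π : Equiv.Perm (Fin n),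
    (fun H => (fun (x : Fin n → ℝ) (k : Fin n) => x (π.symm k)) '' H) '' A = A

theorem hyp_swap (n : ℕ) (i j : Fin n) (s : ℝ) : hyp n i j s = hyp n j i (-s) := by
  ext x
  simp only [hyp, Set.mem_setOf_eq]
  constructor <;> intro h <;> linarith

theorem hyp_inj (n : ℕ) (i j k l : Fin n) (s t : ℝ) (hij : i ≠ j) (hkl : k ≠ l)
    (h : hyp n i j s = hyp n k l t) :
    (i = k ∧ j = l ∧ s = t) ∨ (i = l ∧ j = k ∧ s = -t) := by
  have key : ∀ x : Fin n → ℝ, x i - x j = s → x k - x l = t := by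
    intro x hx
    have : x ∈ hyp n i j s := hx
    rw [h] at this
    exact this
  have aux : ∀ m : Fin n, m ≠ i → m ≠ j → ∀ c : ℝ,
      (fun a : Fin n => if a = i then s else if a = m then c else 0) k
      - (fun a : Fin n => if a = i then s else if a = m then c else 0) l = t := by
    intro m hi hj c
    apply key
    simp [hij.symm, hj.symm]
  have hk : k = i ∨ k = j := by
    by_contra hc
    push Not at hc
    have h0 := aux k hc.1 hc.2 0
    have h1 := aux k hc.1 hc.2 1
    simp only [hc.1, hkl.symm, if_true, if_false] at h0 h1
    linarith
  have hl : l = i ∨ l = j := by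
    by_contra hc
    push Not at hc
    have h0 := aux l hc.1 hc.2 0
    have h1 := aux l hc.1 hc.2 1
    simp only [hc.1, hkl, if_true, if_false] at h0 h1
    linarith
  have h2 := key (fun a => if a = i then s else 0) (by simp [hij.symm])
  rcases hk with rfl | rfl <;> rcases hl with rfl | rfl
  · exact absurd rfl hkl
  · left
    simp [hij.symm] at h2
    exact ⟨rfl, rfl, h2⟩
  · right
    simp [hij.symm] at h2
    exact ⟨rfl, rfl, by linarith⟩
  · exact absurd rfl hkl

theorem image_hyp (n : ℕ) (π : Equiv.Perm (Fin n)) (i j : Fin n) (s : ℝ) :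
    (fun (x : Fin n → ℝ) (k : Fin n) => x (π.symm k)) '' hyp n i j s = hyp n (π i) (π j) s := by
  ext y
  simp only [hyp, Set.mem_image, Set.mem_setOf_eq]
  constructor
  · rintro ⟨x, hx, rfl⟩
    simpa using hx
  · intro hy
    exact ⟨fun k => y (π k), hy, by ext k; simp⟩

theorem mem_arrS (n : ℕ) (S : Set ℤ) (hS : ∀ s : ℤ, s ∈ S ↔ -s ∈ S) (i j : Fin n) (hij : i ≠ j)
    (s : ℤ) : hyp n i j (s : ℝ) ∈ arrS S n ↔ s ∈ S := by
  constructor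
  · rintro ⟨k, l, t, hkl, ht, h⟩
    rcases hyp_inj n i j k l s t hij hkl.ne h with ⟨_, _, h⟩ | ⟨_, _, h⟩
    · have : s = t := by exact_mod_cast h
      rwa [this]
    · have : s = -t := by exact_mod_cast h
      rw [this]
      exact (hS t).1 ht
  · intro hs
    rcases lt_or_gt_of_ne hij with h | h
    · exact ⟨i, j, s, h, hs, rfl⟩
    · exact ⟨j, i, -s, h, (hS s).1 hs, by rw [hyp_swap]; push_cast; rfl⟩

theorem exists_perm (n : ℕ) (i j k l : Fin n) (hij : i ≠ j) (hkl : k ≠ l) :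
    ∃ π : Equiv.Perm (Fin n), π i = k ∧ π j = l := by
  refine ⟨(Equiv.swap i k).trans (Equiv.swap (Equiv.swap i k j) l), ?_, ?_⟩
  · simp only [Equiv.trans_apply, Equiv.swap_apply_left]
    apply Equiv.swap_apply_of_ne_of_ne _ hkl
    intro h
    apply hij
    apply (Equiv.swap i k).injective
    rw [Equiv.swap_apply_left]
    exact h
  · simp

theorem symm_mem (n : ℕ) (A : Set (Set (Fin n → ℝ))) (h : IsSymmetricArr n A)
    (i j k l : Fin n) (hij : i ≠ j) (hkl : k ≠ l) (s : ℝ) (hm : hyp n i j s ∈ A) :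
    hyp n k l s ∈ A := by
  obtain ⟨π, rfl, rfl⟩ := exists_perm n i j k l hij hkl
  rw [← image_hyp, ← h π]
  exact ⟨_, hm, rfl⟩

theorem arrS_image (n : ℕ) (S : Set ℤ) (hS : ∀ s : ℤ, s ∈ S ↔ -s ∈ S) (π : Equiv.Perm (Fin n))
    (H : Set (Fin n → ℝ)) (hH : H ∈ arrS S n) :
    (fun (x : Fin n → ℝ) (k : Fin n) => x (π.symm k)) '' H ∈ arrS S n := by
  obtain ⟨i, j, s, hij, hs, rfl⟩ := hH
  rw [image_hyp, mem_arrS n S hS _ _ (fun h => hij.ne (π.injective h))]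
  exact hs

/-- Lemma 5.2. For `n ≥ 3`, a braid-type arrangement `A ⊆ ℝ^n` is
symmetric and strongly transitive if and only if `A = A_S^n` for some `S ⊆ ℤ` with
`S = -S` and such that `s + t ∉ S` for all `s, t ∈ ℕ ∖ S`. -/
theorem symmetric_strongly_transitive_characterization (n : ℕ) (hn : 3 ≤ n)
    (A : Set (Set (Fin n → ℝ))) (hA : IsBraidType n A) :
    (IsSymmetricArr n A ∧ IsStronglyTransitive n A) ↔
      ∃ S : Set ℤ, (∀ s : ℤ, s ∈ S ↔ -s ∈ S) ∧
        (∀ s t : ℕ, (s : ℤ) ∉ S → (t : ℤ) ∉ S → ((s : ℤ) + (t : ℤ)) ∉ S) ∧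
        A = arrS S n := by
  constructor
  · rintro ⟨hsym, htr⟩
    let a : Fin n := ⟨0, by omega⟩
    let b : Fin n := ⟨1, by omega⟩
    let c : Fin n := ⟨2, by omega⟩
    have hab : a ≠ b := by simp [a, b]
    have hbc : b ≠ c := by simp [b, c]
    have hac : a ≠ c := by simp [a, c]
    refine ⟨{s : ℤ | hyp n a b (s : ℝ) ∈ A}, ?_, ?_, ?_⟩
    · have h1 : ∀ s : ℤ, hyp n a b (s : ℝ) ∈ A → hyp n a b ((-s : ℤ) : ℝ) ∈ A := by
        intro s hs
        rw [hyp_swap] at hs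
        have := symm_mem n A hsym b a a b hab.symm hab _ hs
        push_cast
        exact this
      intro s
      refine ⟨h1 s, fun h => ?_⟩
      have := h1 (-s) h
      rwa [neg_neg] at this
    · intro s t hs ht hst
      simp only [Set.mem_setOf_eq] at hs ht hst
      push_cast at hs ht hst
      exact htr a b c hab hbc hac s t hs
        (fun h => ht (symm_mem n A hsym b c a b hbc hab _ h))
        (symm_mem n A hsym a b a c hab hac _ hst)
    · ext H
      constructor
      · intro hH
        obtain ⟨i, j, s, hij, rfl⟩ := hA.2 H hH
        rcases lt_or_gt_of_ne hij with h | h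
        · exact ⟨i, j, s, h, symm_mem n A hsym i j a b hij hab _ hH, rfl⟩
        · have e : hyp n i j (s : ℝ) = hyp n j i ((-s : ℤ) : ℝ) := by
            rw [hyp_swap]; push_cast; rfl
          rw [e] at hH ⊢
          exact ⟨j, i, -s, h, symm_mem n A hsym j i a b hij.symm hab _ hH, rfl⟩
      · rintro ⟨i, j, s, hij, hs, rfl⟩
        exact symm_mem n A hsym a b i j hab hij.ne _ hs
  · rintro ⟨S, hS, hadd, rfl⟩
    constructor
    · intro π
      ext H
      constructor
      · rintro ⟨K, hK, rfl⟩
        exact arrS_image n S hS π K hK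
      · intro hH
        refine ⟨_, arrS_image n S hS π.symm H hH, ?_⟩
        simp [Set.image_image]
    · intro i j k hij hjk hik s t hs ht
      have e1 := mem_arrS n S hS i j hij s
      have e2 := mem_arrS n S hS j k hjk t
      have e3 := mem_arrS n S hS i k hik ((s : ℤ) + (t : ℤ))
      push_cast at e1 e2 e3
      rw [e1] at hs
      rw [e2] at ht
      rw [e3]
      exact hadd s t hs ht

end Braid
end

section
/- Let S ⊂ ℤ be a finite nonempty set with S = −S and such that s+t ∉ S for all s,t ∈ ℕ∖S, let m = max(S), and let n be a positive integer. (a) If 0 ∈ S, then a marked (m,n)-tree (T,μ) ∈ ŌT_m^n is A_S^n-connected if and only if every block B of blocks(μ) satisfies shadow(B) ∈ 𝒟_S. (b) If 0 ∉ S, then (T,μ) ∈ ŌT_m^n is A_S^n-connected if and only if every block B of blocks(μ) satisfies shadow(B) ∈ 𝒟_S and (|shadow(B)| > 1 or |B| = 1). -/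
open scoped BigOperators Classical

namespace Braid

/-- The `m`-Catalan arrangement `A_m^n = A_{[-m;m]}^n`. -/
def catArr (m n : ℕ) : Set (Set (Fin n → ℝ)) := arrS {s : ℤ | s.natAbs ≤ m} n

/-- `(i,j,s) ∈ Tr_m^n`. -/
def TrIdx (m n : ℕ) (i j : Fin n) (s : ℕ) : Prop := s ≤ m ∧ i ≠ j ∧ (0 < s ∨ j < i)

/-- `(i,j,s) ∈ Tr_m^n(A)`. -/
def TrIdxA (m n : ℕ) (A : Set (Set (Fin n → ℝ))) (i j : Fin n) (s : ℕ) : Prop :=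
  TrIdx m n i j s ∧ hyp n i j (s : ℝ) ∈ A

/-- A transitive arrangement `A ⊆ A_m^n`. -/
def IsTransitive (m n : ℕ) (A : Set (Set (Fin n → ℝ))) : Prop :=
  ∀ i j k : Fin n, i ≠ j → j ≠ k → i ≠ k → ∀ s t : ℕ,
    TrIdx m n i j s → TrIdx m n j k t →
    hyp n i j (s : ℝ) ∉ A → hyp n j k (t : ℝ) ∉ A → hyp n i k ((s : ℝ) + (t : ℝ)) ∉ A

/-- An `(m,n)`-tree: a rooted `(m+1)`-ary tree with `n` nodes labeled by `Fin n`
(leaves unlabeled), encoded by the root-to-node lists of child indices. -/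
structure Tree (m n : ℕ) where
  path : Fin n → List ℕ
  entry_le : ∀ v : Fin n, ∀ s ∈ path v, s ≤ m
  inj : Function.Injective path
  parent_closed : ∀ v : Fin n, path v ≠ [] → ∃ w : Fin n, path w = (path v).dropLast

namespace Tree

variable {m n : ℕ}

/-- The drift of a node. -/
def drift (T : Tree m n) (v : Fin n) : ℕ := (T.path v).sum

/-- `i = s`-child`(j)`. -/
def IsChild (T : Tree m n) (i j : Fin n) (s : ℕ) : Prop := T.path i = T.path j ++ [s]

/-- The `s`-child slot of node `j` is occupied by a node (not a leaf). -/
def SlotNode (T : Tree m n) (j : Fin n) (s : ℕ) : Prop := ∃ i, T.IsChild i j s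

/-- `i = s`-cadet`(j)`. -/
def IsCadet (T : Tree m n) (i j : Fin n) (s : ℕ) : Prop :=
  T.IsChild i j s ∧ ∀ t : ℕ, s < t → t ≤ m → ¬ T.SlotNode j t

end Tree

/-- The order `≺_T` on vertices of a tree, expressed on root-to-vertex paths:
`v ≺_T w` iff `drift(v) < drift(w)`, or the drifts are equal and there is `c ≤ k`
(`k` the length of the path of `v`) with the first `c` entries of both paths equal and
(`c = k` or the entry of the path of `v` at position `c+1` is larger than that of `w`). -/
def vlt (p q : List ℕ) : Prop :=
  p.sum < q.sum ∨
    (p.sum = q.sum ∧ ∃ c ≤ p.length, p.take c = q.take c ∧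
      (c = p.length ∨ ∃ (h1 : c < p.length) (h2 : c < q.length), q.get ⟨c, h2⟩ < p.get ⟨c, h1⟩))

/-- `p ≽_T q`. -/
def vge (p q : List ℕ) : Prop := vlt q p ∨ p = q

/-- A valid marking: `μ` is the set of (lower endpoints of) marked edges; each marked
edge is a cadet edge, and marked `0`-cadet edges `{j, 0cadet(j)}` satisfy `j < 0cadet(j)`. -/
def IsMarking {m n : ℕ} (T : Tree m n) (μ : Set (Fin n)) : Prop :=
  ∀ i ∈ μ, ∃ j s, T.IsCadet i j s ∧ (s = 0 → (j : ℕ) < (i : ℕ))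

/-- The relation `i ∼_μ j`: all edges on the tree path between `i` and `j` are marked. -/
def simMu {m n : ℕ} (T : Tree m n) (μ : Set (Fin n)) : Fin n → Fin n → Prop :=
  Relation.ReflTransGen (fun a b =>
    (a ∈ μ ∧ ∃ s, T.IsChild a b s) ∨ (b ∈ μ ∧ ∃ s, T.IsChild b a s))

/-- The block containing node `i`. -/
def blockOf {m n : ℕ} (T : Tree m n) (μ : Set (Fin n)) (i : Fin n) : Set (Fin n) :=
  {j | simMu T μ i j}

/-- The set of blocks of a marked tree. -/
def blocksOf {m n : ℕ} (T : Tree m n) (μ : Set (Fin n)) : Set (Set (Fin n)) :=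
  {B | ∃ i, B = blockOf T μ i}

/-- The block `B` is `A`-connected. -/
def BlockConnected {m n : ℕ} (A : Set (Set (Fin n → ℝ))) (T : Tree m n)
    (B : Set (Fin n)) : Prop :=
  ∀ i ∈ B, ∀ j ∈ B, Relation.ReflTransGen
    (fun a b => a ∈ B ∧ b ∈ B ∧ hyp n a b ((T.drift a : ℝ) - (T.drift b : ℝ)) ∈ A) i j

/-- The marked tree `(T,μ)` is `A`-connected. -/
def AConnected {m n : ℕ} (A : Set (Set (Fin n → ℝ))) (T : Tree m n)
    (μ : Set (Fin n)) : Prop :=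
  ∀ B ∈ blocksOf T μ, BlockConnected A T B

/-- The `A`-cadet condition. -/
def CadetCond {m n : ℕ} (A : Set (Set (Fin n → ℝ))) (T : Tree m n)
    (μ : Set (Fin n)) : Prop :=
  ∀ i j s, T.IsCadet i j s → i ∉ μ →
    ((s = 0 ∧ (i : ℕ) < (j : ℕ)) ∨
      ∃ i' j', simMu T μ i i' ∧ simMu T μ j j' ∧
        hyp n i' j' ((T.drift i' : ℝ) - (T.drift j' : ℝ)) ∈ A)

/-- The set `ŌT_m^n` of all marked `(m,n)`-trees. -/
def OTall (m n : ℕ) : Set (Tree m n × Set (Fin n)) := {p | IsMarking p.1 p.2}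

/-- The set `ŌT_m^n(A)`. -/
def OTset (m n : ℕ) (A : Set (Set (Fin n → ℝ))) : Set (Tree m n × Set (Fin n)) :=
  {p | IsMarking p.1 p.2 ∧ AConnected A p.1 p.2 ∧ CadetCond A p.1 p.2}

/-- The set `T_m^n(A)` of (unmarked) trees. -/
def Tset (m n : ℕ) (A : Set (Set (Fin n → ℝ))) : Set (Tree m n) :=
  {T | ∀ i j s, TrIdx m n i j s → hyp n i j (s : ℝ) ∉ A → ¬ T.IsCadet i j s}

/-- The region `Φ_A(T)`. -/
def Phi (m n : ℕ) (A : Set (Set (Fin n → ℝ))) (T : Tree m n) : Set (Fin n → ℝ) :=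
  {x | ∀ i j : Fin n, ∀ s : ℕ, TrIdxA m n A i j s →
        (vlt (T.path i) (T.path j ++ [s]) → x i - x j < (s : ℝ)) ∧
        (vge (T.path i) (T.path j ++ [s]) → (s : ℝ) < x i - x j)}

/-- The polyhedron `Φ̄_A(T,μ)`. -/
def PhiBar (m n : ℕ) (A : Set (Set (Fin n → ℝ))) (T : Tree m n) (μ : Set (Fin n)) :
    Set (Fin n → ℝ) :=
  {x | (∀ i ∈ μ, ∀ j s, T.IsChild i j s → x i - x j = (s : ℝ)) ∧
       ∀ i j : Fin n, ∀ s : ℕ, TrIdxA m n A i j s → ¬ simMu T μ i j →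
         (vlt (T.path i) (T.path j ++ [s]) → x i - x j < (s : ℝ)) ∧
         (vge (T.path i) (T.path j ++ [s]) → (s : ℝ) < x i - x j)}

/-- `R` is a region of `A`: a connected component of the complement of the union of `A`. -/
def IsRegion (n : ℕ) (A : Set (Set (Fin n → ℝ))) (R : Set (Fin n → ℝ)) : Prop :=
  ∃ x ∈ (⋃₀ A)ᶜ, R = connectedComponentIn (⋃₀ A)ᶜ x

/-- `σ` is the hyperplane `H` itself or one of the two open half-spaces bounded by `H`. -/
def IsSideOf (n : ℕ) (σ H : Set (Fin n → ℝ)) : Prop :=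
  σ = H ∨ ∃ (i j : Fin n) (s : ℝ), H = hyp n i j s ∧
    (σ = {x | x i - x j < s} ∨ σ = {x | s < x i - x j})

/-- `F` is a face of the arrangement `A`. -/
def IsFace (n : ℕ) (A : Set (Set (Fin n → ℝ))) (F : Set (Fin n → ℝ)) : Prop :=
  F.Nonempty ∧ ∃ σ : Set (Fin n → ℝ) → Set (Fin n → ℝ),
    (∀ H ∈ A, IsSideOf n (σ H) H) ∧ F = ⋂ H ∈ A, σ H

/-- The dimension of (the affine hull of) a subset of `ℝ^n`. -/
noncomputable def faceDim (n : ℕ) (F : Set (Fin n → ℝ)) : ℕ :=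
  Module.finrank ℝ (affineSpan ℝ F).direction

/-- The shadow of a block `B` of a marked tree:
`shadow(B) = {drift(j) - drift(a) : j ∈ B}` where `a ∈ B` is the ancestor of all of `B`. -/
def shadowOf {m n : ℕ} (T : Tree m n) (B : Set (Fin n)) : Set ℕ :=
  {d | ∃ a ∈ B, (∀ i ∈ B, T.path a <+: T.path i) ∧ ∃ j ∈ B, T.drift j = T.drift a + d}

/-- `D` is an `S`-shadow: a finite subset of `ℕ` containing `0` such that the graph on `D`
with an edge `{i,j}` whenever `i - j ∈ S` is connected. -/
def IsShadow (S : Set ℤ) (D : Set ℕ) : Prop :=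
  D.Finite ∧ 0 ∈ D ∧ ∀ i ∈ D, ∀ j ∈ D,
    Relation.ReflTransGen
      (fun a b => a ∈ D ∧ b ∈ D ∧ (((a : ℤ) - (b : ℤ)) ∈ S ∨ ((b : ℤ) - (a : ℤ)) ∈ S)) i j

/-- `start(D) = D ∩ [m-1]`. -/
def startSh (m : ℕ) (D : Set ℕ) : Set ℕ := D ∩ Set.Icc 1 (m - 1)

/-- `end(D) = (max(D) - D) ∩ [m-1]`. -/
def endSh (m : ℕ) (D : Set ℕ) : Set ℕ := {e | ∃ d ∈ D, e + d = sSup D} ∩ Set.Icc 1 (m - 1)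

/-- The connection set `C_S^{V,W}`. -/
def connSet (S : Set ℤ) (m : ℕ) (V W : Set ℕ) : Set ℕ :=
  {0} ∪ {s | 1 ≤ s ∧ s ≤ m ∧ ∃ d ∈ insert 0 V, ∃ d' ∈ insert 0 W,
    ((s : ℤ) + (d : ℤ) + (d' : ℤ)) ∈ S}
theorem hyp_mem_arrS {S : Set ℤ} (hsym : ∀ s : ℤ, s ∈ S ↔ -s ∈ S) {n : ℕ} (a b : Fin n)
    (p q : ℕ) :
    hyp n a b ((p : ℝ) - (q : ℝ)) ∈ arrS S n ↔ a ≠ b ∧ ((p : ℤ) - (q : ℤ)) ∈ S := by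
  constructor
  · rintro ⟨i, j, s, hij, hs, h⟩
    have hne : i ≠ j := ne_of_lt hij
    have key : ∀ x : Fin n → ℝ, x a - x b = (p : ℝ) - q ↔ x i - x j = s := fun x => by
      have := Set.ext_iff.1 h x
      exact this
    have h0 := (key (fun k => if k = i then (s : ℝ) else 0)).2 (by simp [hne.symm])
    have hab : a ≠ b := by
      rintro rfl
      have h1 := (key (fun k => if k = i then (s : ℝ) + 1 else 0)).1 (by
        rw [← h0]; simp)
      simp [hne.symm] at h1
    have ha : a = i ∨ a = j := by
      by_contra hc
      push Not at hc
      have h1 := (key (fun k => (if k = i then (s : ℝ) else 0) + if k = a then 1 else 0)).2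
        (by simp [hne.symm, hc.1.symm, hc.2.symm])
      simp only [if_true, if_neg hab.symm] at h1
      linarith
    have hb : b = i ∨ b = j := by
      by_contra hc
      push Not at hc
      have h1 := (key (fun k => (if k = i then (s : ℝ) else 0) + if k = b then 1 else 0)).2
        (by simp [hne.symm, hc.1.symm, hc.2.symm])
      simp only [if_true, if_neg hab] at h1
      linarith
    refine ⟨hab, ?_⟩
    rcases ha with rfl | rfl <;> rcases hb with rfl | rfl
    · exact absurd rfl hab
    · simp [hne.symm] at h0
      have : (p : ℤ) - q = s := by exact_mod_cast h0.symm
      rw [this]; exact hs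
    · simp [hne.symm] at h0
      have h2 : ((-s : ℤ) : ℝ) = (((p : ℤ) - q : ℤ) : ℝ) := by push_cast; exact h0
      have : -s = (p : ℤ) - q := by exact_mod_cast h2
      rw [← this]; exact (hsym s).1 hs
    · exact absurd rfl hab
  · rintro ⟨hab, hs⟩
    rcases lt_or_gt_of_ne hab with h | h
    · exact ⟨a, b, _, h, hs, by push_cast; rfl⟩
    · refine ⟨b, a, _, h, (hsym _).1 hs, ?_⟩
      ext x
      simp only [hyp, Set.mem_ofPred_eq]
      push_cast
      constructor <;> intro h <;> linarith

theorem exists_top {m n : ℕ} (T : Tree m n) (μ : Set (Fin n)) (hμ : IsMarking T μ)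
    (B : Set (Fin n)) (hB : B ∈ blocksOf T μ) :
    ∃ t ∈ B, ∀ j ∈ B, T.path t <+: T.path j := by
  obtain ⟨i, rfl⟩ := hB
  obtain ⟨t, ht, hmin⟩ := Set.exists_min_image (blockOf T μ i) (fun k => (T.path k).length)
    (Set.toFinite _) ⟨i, Relation.ReflTransGen.refl⟩
  have htμ : t ∉ μ := by
    intro h
    obtain ⟨j, s, hc, -⟩ := hμ t h
    have hj : j ∈ blockOf T μ i := Relation.ReflTransGen.tail ht (Or.inl ⟨h, s, hc.1⟩)
    have h1 := hmin j hj
    have h2 : T.path t = T.path j ++ [s] := hc.1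
    simp [h2] at h1
  refine ⟨t, ht, fun j hj => ?_⟩
  have hs : simMu T μ t i := by
    have ht' : simMu T μ i t := ht
    clear hmin ht
    clear htμ
    induction ht' with
    | refl => exact Relation.ReflTransGen.refl
    | tail _ h ih => exact Relation.ReflTransGen.head h.symm ih
  have htj : simMu T μ t j := hs.trans hj
  clear hj hs
  induction htj with
  | refl => exact List.prefix_rfl
  | tail _ h ih =>
    rename_i b c _
    rcases h with ⟨hb, s, hc⟩ | ⟨hb, s, hc⟩
    · have hc' : T.path b = T.path c ++ [s] := hc
      rw [hc', List.prefix_concat_iff] at ih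
      rcases ih with h | h
      · rw [← hc'] at h
        exact absurd (T.inj h ▸ hb) htμ
      · exact h
    · have hc' : T.path c = T.path b ++ [s] := hc
      rw [hc']
      exact ih.trans (List.prefix_append _ _)

theorem shadow_eq {m n : ℕ} (T : Tree m n) (B : Set (Fin n)) (t : Fin n) (ht : t ∈ B)
    (hp : ∀ j ∈ B, T.path t <+: T.path j) :
    shadowOf T B = {d | ∃ j ∈ B, T.drift j = T.drift t + d} := by
  ext d
  constructor
  · rintro ⟨a, ha, hpa, h⟩
    have : a = t := T.inj ((hpa t ht).eq_of_length_le (hp a ha).length_le)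
    subst this
    exact h
  · intro h
    exact ⟨t, ht, hp, h⟩

def EE {n : ℕ} (S : Set ℤ) (B : Set (Fin n)) (f : Fin n → ℕ) (a b : Fin n) : Prop :=
  a ∈ B ∧ b ∈ B ∧ a ≠ b ∧ ((f a : ℤ) - (f b : ℤ)) ∈ S

def Conn {n : ℕ} (S : Set ℤ) (B : Set (Fin n)) (f : Fin n → ℕ) : Prop :=
  ∀ i ∈ B, ∀ j ∈ B, Relation.ReflTransGen (EE S B f) i j

section core
variable {n : ℕ} {S : Set ℤ} (hsym : ∀ s : ℤ, s ∈ S ↔ -s ∈ S) {B : Set (Fin n)}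
  {f : Fin n → ℕ} {t : Fin n} (ht : t ∈ B) (hf : ∀ j ∈ B, f t ≤ f j)

include ht hf in
theorem conn_shadow (h : Conn S B f) : IsShadow S {d | ∃ j ∈ B, f j = f t + d} := by
  refine ⟨?_, ⟨t, ht, rfl⟩, ?_⟩
  · refine Set.Finite.subset ((Set.toFinite B).image (fun j => f j - f t)) ?_
    rintro d ⟨j, hj, h⟩
    exact ⟨j, hj, by simp [h]⟩
  · rintro x ⟨i, hi, hx⟩ y ⟨j, hj, hy⟩
    have hx' : x = f i - f t := by omega
    have hy' : y = f j - f t := by omega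
    rw [hx', hy']
    refine Relation.ReflTransGen.lift (fun k => f k - f t) ?_ _ _ (h i hi j hj)
    rintro a b ⟨ha, hb, -, hs⟩
    have h1 := hf a ha
    have h2 := hf b hb
    refine ⟨⟨a, ha, by dsimp only; omega⟩, ⟨b, hb, by dsimp only; omega⟩, Or.inl ?_⟩
    have : ((f a - f t : ℕ) : ℤ) - ((f b - f t : ℕ) : ℤ) = (f a : ℤ) - f b := by omega
    rw [this]; exact hs

include hsym in
theorem edge_of {x y : ℕ} {i j : Fin n} (hi : i ∈ B) (hj : j ∈ B) (hx : f i = f t + x)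
    (hy : f j = f t + y) (hij : i ≠ j)
    (h : ((x : ℤ) - (y : ℤ)) ∈ S ∨ ((y : ℤ) - (x : ℤ)) ∈ S) : EE S B f i j := by
  refine ⟨hi, hj, hij, ?_⟩
  have : (f i : ℤ) - f j = (x : ℤ) - y := by omega
  rw [this]
  rcases h with h | h
  · exact h
  · rw [hsym, neg_sub]; exact h

include hsym hf in
theorem shadow_conn (h : IsShadow S {d | ∃ j ∈ B, f j = f t + d})
    (hs : ∀ i ∈ B, ∀ j ∈ B, f i = f j → Relation.ReflTransGen (EE S B f) i j) :
    Conn S B f := by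
  intro i hi j hj
  obtain ⟨x, hx⟩ := Nat.exists_eq_add_of_le (hf i hi)
  obtain ⟨y, hy⟩ := Nat.exists_eq_add_of_le (hf j hj)
  have h2 := h.2.2 x ⟨i, hi, hx⟩ y ⟨j, hj, hy⟩
  clear h
  induction h2 generalizing j with
  | refl => exact hs i hi j hj (by omega)
  | tail _ e ih =>
    obtain ⟨⟨k, hk, hky⟩, -, e⟩ := e
    have h3 := ih k hk hky
    by_cases hkj : k = j
    · exact hkj ▸ h3
    · exact h3.tail (edge_of hsym hk hj hky hy hkj e)

theorem same_zero (h0 : (0 : ℤ) ∈ S) :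
    ∀ i ∈ B, ∀ j ∈ B, f i = f j → Relation.ReflTransGen (EE S B f) i j := by
  intro i hi j hj h
  by_cases hij : i = j
  · rw [hij]
  · exact Relation.ReflTransGen.single ⟨hi, hj, hij, by simpa [h] using h0⟩

include hsym hf in
theorem same_nonzero (h0 : (0 : ℤ) ∉ S) (h : IsShadow S {d | ∃ j ∈ B, f j = f t + d})
    (hc : 1 < ({d | ∃ j ∈ B, f j = f t + d} : Set ℕ).ncard) :
    ∀ i ∈ B, ∀ j ∈ B, f i = f j → Relation.ReflTransGen (EE S B f) i j := by
  intro i hi j hj hij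
  obtain ⟨x, hx⟩ := Nat.exists_eq_add_of_le (hf i hi)
  obtain ⟨y, hy, hne⟩ := Set.exists_ne_of_one_lt_ncard hc x
  rcases Relation.ReflTransGen.cases_head (h.2.2 x ⟨i, hi, hx⟩ y hy) with h1 | ⟨z, e, -⟩
  · exact absurd h1.symm hne
  · obtain ⟨-, ⟨k, hk, hkz⟩, e⟩ := e
    have hxz : x ≠ z := by
      rintro rfl
      simp [h0] at e
    have hik : i ≠ k := by
      rintro rfl
      omega
    have hkj : k ≠ j := by
      rintro rfl
      omega
    exact (Relation.ReflTransGen.single (edge_of hsym hi hk hx hkz hik e)).tail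
      (edge_of hsym hk hj hkz (hij ▸ hx) hkj e.symm)

include ht hf in
theorem conn_card (h0 : (0 : ℤ) ∉ S) (h : Conn S B f) :
    1 < ({d | ∃ j ∈ B, f j = f t + d} : Set ℕ).ncard ∨ B.ncard = 1 := by
  by_cases hB : B.ncard = 1
  · exact Or.inr hB
  left
  have hpos : 0 < B.ncard := (Set.ncard_pos (Set.toFinite B)).2 ⟨t, ht⟩
  obtain ⟨b, hb, hne⟩ := Set.exists_ne_of_one_lt_ncard (by omega : 1 < B.ncard) t
  rcases Relation.ReflTransGen.cases_head (h t ht b hb) with h1 | ⟨k, ⟨-, hk, -, e⟩, -⟩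
  · exact absurd h1.symm hne
  · have : f t ≠ f k := by
      intro hh
      simp [hh, h0] at e
    have h2 := hf k hk
    rw [Set.one_lt_ncard (conn_shadow ht hf h).1]
    exact ⟨0, ⟨t, ht, rfl⟩, f k - f t, ⟨k, hk, by omega⟩, by omega⟩

end core

theorem blockConn_iff {S : Set ℤ} (hsym : ∀ s : ℤ, s ∈ S ↔ -s ∈ S) {m n : ℕ} (T : Tree m n)
    (B : Set (Fin n)) : BlockConnected (arrS S n) T B ↔ Conn S B T.drift := by
  unfold BlockConnected Conn
  have : (fun a b => a ∈ B ∧ b ∈ B ∧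
      hyp n a b ((T.drift a : ℝ) - (T.drift b : ℝ)) ∈ arrS S n) = EE S B T.drift := by
    funext a b
    simp only [EE, hyp_mem_arrS hsym]
  rw [this]

theorem drift_mono {m n : ℕ} (T : Tree m n) {a b : Fin n} (h : T.path a <+: T.path b) :
    T.drift a ≤ T.drift b := by
  obtain ⟨l, hl⟩ := h
  simp [Tree.drift, ← hl]

/-- Lemma 5.9. Let `S ⊂ ℤ` be finite nonempty with `S = -S` and
`s+t ∉ S` for all `s,t ∈ ℕ∖S`, `m = max S`. (a) If `0 ∈ S`, a marked `(m,n)`-tree is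
`A_S^n`-connected iff every block `B` satisfies `shadow(B) ∈ 𝒟_S`. (b) If `0 ∉ S`, it is
`A_S^n`-connected iff every block `B` satisfies `shadow(B) ∈ 𝒟_S` and
(`|shadow(B)| > 1` or `|B| = 1`). -/
theorem shadow_connectivity (S : Set ℤ) (hfin : S.Finite) (hne : S.Nonempty)
    (hsym : ∀ s : ℤ, s ∈ S ↔ -s ∈ S)
    (hclosed : ∀ s t : ℕ, (s : ℤ) ∉ S → (t : ℤ) ∉ S → ((s : ℤ) + (t : ℤ)) ∉ S)
    (m : ℕ) (hmS : (m : ℤ) ∈ S) (hmax : ∀ s ∈ S, s ≤ (m : ℤ))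
    (n : ℕ) (hn : 0 < n) (T : Tree m n) (μ : Set (Fin n)) (hμ : IsMarking T μ) :
    ((0 : ℤ) ∈ S →
      (AConnected (arrS S n) T μ ↔
        ∀ B ∈ blocksOf T μ, IsShadow S (shadowOf T B))) ∧
    ((0 : ℤ) ∉ S →
      (AConnected (arrS S n) T μ ↔
        ∀ B ∈ blocksOf T μ, IsShadow S (shadowOf T B) ∧
          (1 < (shadowOf T B).ncard ∨ B.ncard = 1))) := by
  have main : ∀ B ∈ blocksOf T μ,
      ((0 : ℤ) ∈ S → (BlockConnected (arrS S n) T B ↔ IsShadow S (shadowOf T B))) ∧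
      ((0 : ℤ) ∉ S → (BlockConnected (arrS S n) T B ↔ IsShadow S (shadowOf T B) ∧
          (1 < (shadowOf T B).ncard ∨ B.ncard = 1))) := by
    intro B hB
    obtain ⟨t, ht, hp⟩ := exists_top T μ hμ B hB
    have hf : ∀ j ∈ B, T.drift t ≤ T.drift j := fun j hj => drift_mono T (hp j hj)
    rw [shadow_eq T B t ht hp, blockConn_iff hsym]
    refine ⟨fun h0 => ⟨conn_shadow ht hf, fun h => shadow_conn hsym hf h (same_zero h0)⟩,
      fun h0 => ⟨fun h => ⟨conn_shadow ht hf h, conn_card ht hf h0 h⟩, ?_⟩⟩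
    rintro ⟨h, hc | hc⟩
    · exact shadow_conn hsym hf h (same_nonzero hsym hf h0 h hc)
    · obtain ⟨a, rfl⟩ := Set.ncard_eq_one.1 hc
      rintro i rfl j rfl
      exact Relation.ReflTransGen.refl
  exact ⟨fun h0 => forall₂_congr fun B hB => (main B hB).1 h0,
    fun h0 => forall₂_congr fun B hB => (main B hB).2 h0⟩

end Braid
end

section
/- Let S ⊂ ℤ be a finite nonempty set with S = −S and such that s+t ∉ S for all s,t ∈ ℕ∖S, and let m = max(S). For all U,V ⊆ [m−1], the formal power series D_S^{U,V}(X,Y) ∈ ℚ[[X,Y]] is rational: there exist polynomials P,Q ∈ ℚ[X,Y] with Q(0,0) ≠ 0 such that Q(X,Y)·D_S^{U,V}(X,Y) = P(X,Y) in ℚ[[X,Y]]. -/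
namespace Braid

/-- `D` is an `S`-shadow: a finite subset of `ℕ` containing `0` such that the graph on `D`
with an edge `{i,j}` whenever `i - j ∈ S` is connected. -/
def IsShadowF (S : Set ℤ) (D : Finset ℕ) : Prop :=
  0 ∈ D ∧ ∀ i ∈ D, ∀ j ∈ D,
    Relation.ReflTransGen
      (fun a b => a ∈ D ∧ b ∈ D ∧ (((a : ℤ) - (b : ℤ)) ∈ S ∨ ((b : ℤ) - (a : ℤ)) ∈ S)) i j

/-- `start(D) = D ∩ [m-1]`. -/
def startF (m : ℕ) (D : Finset ℕ) : Finset ℕ := D ∩ Finset.Icc 1 (m - 1)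

/-- `end(D) = (max(D) - D) ∩ [m-1]`. -/
def endF (m : ℕ) (D : Finset ℕ) : Finset ℕ :=
  (D.image fun d => D.sup id - d) ∩ Finset.Icc 1 (m - 1)

/-- The bivariate power series `D_S^{U,V}(X,Y) = Σ_{D ∈ 𝒟_S^{U,V}} X^{|D|} Y^{max(D)}`:
its coefficient on `X^a Y^b` is the number of `S`-shadows `D` with `start(D) = U`,
`end(D) = V`, `|D| = a` and `max(D) = b`. -/
noncomputable def DSeries (S : Set ℤ) (m : ℕ) (U V : Finset ℕ) :
    MvPowerSeries (Fin 2) ℚ :=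
  fun e => (Nat.card {D : Finset ℕ // IsShadowF S D ∧ startF m D = U ∧ endF m D = V ∧
    D.card = e 0 ∧ D.sup id = e 1} : ℚ)

open Finset in
/-- Cramer: a linear system with contracting polynomial matrix has rational solutions. -/
theorem cramer_rational {σ : Type} [Fintype σ] [DecidableEq σ]
    (F : σ → MvPowerSeries (Fin 2) ℚ) (A : Matrix σ σ (MvPolynomial (Fin 2) ℚ))
    (b : σ → MvPolynomial (Fin 2) ℚ)
    (hA : ∀ i j, MvPolynomial.constantCoeff (A i j) = 0)
    (hF : ∀ q, F q = (b q : MvPowerSeries (Fin 2) ℚ) +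
      ∑ r, (A q r : MvPowerSeries (Fin 2) ℚ) * F r) :
    ∃ (Q : MvPolynomial (Fin 2) ℚ) (P : σ → MvPolynomial (Fin 2) ℚ),
      MvPolynomial.coeff 0 Q ≠ 0 ∧
      ∀ q, (Q : MvPowerSeries (Fin 2) ℚ) * F q = (P q : MvPowerSeries (Fin 2) ℚ) := by
  classical
  let φ : MvPolynomial (Fin 2) ℚ →+* MvPowerSeries (Fin 2) ℚ :=
    MvPolynomial.coeToMvPowerSeries.ringHom
  have hφ : ∀ p : MvPolynomial (Fin 2) ℚ, φ p = (p : MvPowerSeries (Fin 2) ℚ) := fun p => rfl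
  refine ⟨(1 - A).det, (1 - A).adjugate.mulVec b, ?_, ?_⟩
  · have : MvPolynomial.coeff 0 (1 - A).det = MvPolynomial.constantCoeff (1 - A).det := by
      rw [MvPolynomial.constantCoeff_eq]
    rw [this, RingHom.map_det]
    have : (MvPolynomial.constantCoeff (R := ℚ) (σ := Fin 2)).mapMatrix (1 - A) = 1 := by
      rw [map_sub, map_one]
      ext i j
      simp [hA]
    rw [this]; simp
  · intro q
    have h1 : (φ.mapMatrix (1 - A)).mulVec F = fun q => φ (b q) := by
      rw [map_sub, map_one, Matrix.sub_mulVec, Matrix.one_mulVec]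
      funext q
      simp only [Pi.sub_apply, Matrix.mulVec, dotProduct, RingHom.mapMatrix_apply, Matrix.map_apply,
        hφ]
      rw [sub_eq_iff_eq_add]
      exact hF q
    have h2 := congrArg (fun v => (φ.mapMatrix (1 - A)).adjugate.mulVec v) h1
    simp only [Matrix.mulVec_mulVec, Matrix.adjugate_mul, Matrix.smul_mulVec, Matrix.one_mulVec] at h2
    have h3 := congrFun h2 q
    rw [← RingHom.map_det, ← RingHom.map_adjugate] at h3
    simp only [Pi.smul_apply, smul_eq_mul, hφ] at h3
    rw [h3]
    simp only [Matrix.mulVec, dotProduct, RingHom.mapMatrix_apply, Matrix.map_apply, ← hφ, map_sum,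
      map_mul]

/-- Number of sets in `[0,n]` of size `k` containing `0` with state satisfying `p`. -/
noncomputable def cnt {σ : Type} (st : ℕ → Finset ℕ → σ) (p : σ → Prop) (k n : ℕ) : ℕ :=
  by classical exact
    (((Finset.range (n + 1)).powersetCard k).filter (fun D => 0 ∈ D ∧ p (st n D))).card

theorem cnt_zero_left {σ : Type} (st : ℕ → Finset ℕ → σ) (p : σ → Prop) (n : ℕ) :
    cnt st p 0 n = 0 := by
  classical
  simp [cnt, Finset.filter_singleton]

theorem cnt_zero_right {σ : Type} (st : ℕ → Finset ℕ → σ) (p : σ → Prop) [DecidablePred p]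
    (k : ℕ) : cnt st p k 0 = if k = 1 ∧ p (st 0 {0}) then 1 else 0 := by
  classical
  rcases k with _ | _ | k
  · simp [cnt_zero_left]
  · have : Finset.powersetCard 1 (Finset.range 1) = {{0}} := by decide
    unfold cnt
    rw [Nat.zero_add, this, Finset.filter_singleton]
    by_cases hp : p (st 0 {0}) <;> simp [hp]
  · have : Finset.powersetCard (k+1+1) (Finset.range (0+1)) = ∅ := by
      apply Finset.powersetCard_eq_empty.2; simp
    simp [cnt, this]

theorem cnt_succ {σ : Type} (st : ℕ → Finset ℕ → σ) (p : σ → Prop) (δ : σ → Bool → σ)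
    (hst : ∀ n D, st (n + 1) D = δ (st n D) (decide (n + 1 ∈ D)))
    (hloc : ∀ n D, st n (insert (n + 1) D) = st n D) (k n : ℕ) :
    cnt st p (k + 1) (n + 1) = cnt st (fun q => p (δ q false)) (k + 1) n
      + cnt st (fun q => p (δ q true)) k n := by
  classical
  unfold cnt
  rw [Finset.range_add_one (n := n + 1), Finset.powersetCard_succ_insert (by simp),
    Finset.filter_union, Finset.card_union_of_disjoint]
  · congr 1
    · congr 1
      apply Finset.filter_congr
      intro D hD
      have : n + 1 ∉ D := fun h => by
        have := (Finset.mem_powersetCard.1 hD).1 h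
        simp at this
      simp [hst, this]
    · rw [Finset.filter_image, Finset.card_image_of_injOn]
      · congr 1
        apply Finset.filter_congr
        intro D hD
        simp [hst, hloc]
      · intro D hD E hE h
        have h1 : n + 1 ∉ D := fun h => by
          have := (Finset.mem_powersetCard.1 (Finset.mem_filter.1 hD).1).1 h
          simp at this
        have h2 : n + 1 ∉ E := fun h => by
          have := (Finset.mem_powersetCard.1 (Finset.mem_filter.1 hE).1).1 h
          simp at this
        have := congrArg (fun X => Finset.erase X (n + 1)) h
        simpa [h1, h2] using this
  · rw [Finset.disjoint_left]
    intro D hD hD'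
    simp only [Finset.mem_filter, Finset.mem_image] at hD hD'
    obtain ⟨⟨E, _, rfl⟩, _⟩ := hD'
    have := (Finset.mem_powersetCard.1 hD.1).1 (Finset.mem_insert_self _ _)
    simp at this

open Classical in
theorem cnt_sum {σ : Type} [Fintype σ] (st : ℕ → Finset ℕ → σ) (p : σ → Prop) (k n : ℕ) :
    cnt st p k n = ∑ r, if p r then cnt st (fun q => q = r) k n else 0 := by
  rw [← Finset.sum_filter]
  unfold cnt
  rw [Finset.card_eq_sum_card_fiberwise (f := st n) (t := Finset.univ.filter p)]
  · apply Finset.sum_congr rfl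
    intro r hr
    rw [Finset.filter_filter]
    congr 1
    apply Finset.filter_congr
    intro D hD
    simp at hr
    constructor
    · rintro ⟨⟨a, b⟩, c⟩; exact ⟨a, c⟩
    · rintro ⟨a, c⟩; exact ⟨⟨a, by rw [c]; exact hr⟩, c⟩
  · intro D hD
    simp at hD ⊢
    exact hD.2.2

/-- The series of the counts. -/
noncomputable def cntSeries {σ : Type} (st : ℕ → Finset ℕ → σ) (p : σ → Prop) :
    MvPowerSeries (Fin 2) ℚ := fun e => (cnt st p (e 0) (e 1) : ℚ)

open Classical in
theorem transfer_rational {σ : Type} [Fintype σ] (st : ℕ → Finset ℕ → σ) (p : σ → Prop)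
    (δ : σ → Bool → σ)
    (hst : ∀ n D, st (n + 1) D = δ (st n D) (decide (n + 1 ∈ D)))
    (hloc : ∀ n D, st n (insert (n + 1) D) = st n D) :
    ∃ P Q : MvPolynomial (Fin 2) ℚ, MvPolynomial.coeff 0 Q ≠ 0 ∧
      (Q : MvPowerSeries (Fin 2) ℚ) * cntSeries st p = (P : MvPowerSeries (Fin 2) ℚ) := by
  let F : σ → MvPowerSeries (Fin 2) ℚ := fun q => cntSeries st (fun r => r = q)
  have hFc : ∀ q e, MvPowerSeries.coeff e (F q) = (cnt st (fun r => r = q) (e 0) (e 1) : ℚ) :=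
    fun _ _ => rfl
  let y : Fin 2 →₀ ℕ := Finsupp.single 1 1
  let xy : Fin 2 →₀ ℕ := Finsupp.single 0 1 + Finsupp.single 1 1
  let A : Matrix σ σ (MvPolynomial (Fin 2) ℚ) := fun q r =>
    MvPolynomial.monomial y (if δ r false = q then 1 else 0) +
    MvPolynomial.monomial xy (if δ r true = q then 1 else 0)
  let b : σ → MvPolynomial (Fin 2) ℚ := fun q =>
    MvPolynomial.monomial (Finsupp.single 0 1) (if st 0 {0} = q then 1 else 0)
  have hy : y ≠ 0 := by simp [y]
  have hxy : xy ≠ 0 := by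
    intro h
    have := DFunLike.congr_fun h 0
    simp [xy] at this
  obtain ⟨Q, P, hQ, hP⟩ := cramer_rational F A b
    (by
      intro i j
      simp only [A, map_add, MvPolynomial.constantCoeff_monomial]
      simp [hy, hxy])
    (by
      intro q
      ext e
      have he : ∀ d : Fin 2 →₀ ℕ, d ≤ e ↔ d 0 ≤ e 0 ∧ d 1 ≤ e 1 := by
        intro d
        constructor
        · intro h; exact ⟨h 0, h 1⟩
        · rintro ⟨h, h'⟩ i; fin_cases i <;> assumption
      have he' : e = Finsupp.single 0 1 ↔ e 0 = 1 ∧ e 1 = 0 := by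
        constructor
        · rintro rfl; simp
        · rintro ⟨h, h'⟩; ext i; fin_cases i <;> simp [h, h']
      simp only [map_add, map_sum, A, b, MvPolynomial.coe_add, MvPolynomial.coe_monomial, add_mul,
        MvPowerSeries.coeff_monomial_mul, MvPowerSeries.coeff_monomial, hFc, he, he', y, xy]
      simp only [Finsupp.add_apply, Finsupp.single_apply, Finsupp.tsub_apply]
      generalize e 0 = k
      generalize e 1 = n
      rcases n with _ | n
      · simp [cnt_zero_right]
        split_ifs <;> first | rfl | tauto
      rcases k with _ | k
      · simp [cnt_zero_left]
      · rw [cnt_succ st _ δ hst hloc, cnt_sum st (fun r => δ r false = q),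
          cnt_sum st (fun r => δ r true = q)]
        simp [Finset.sum_add_distrib])
  refine ⟨∑ r, if p r then P r else 0, Q, hQ, ?_⟩
  have : cntSeries st p = ∑ r, if p r then F r else 0 := by
    ext e
    rw [map_sum]
    change (cnt st p (e 0) (e 1) : ℚ) = _
    rw [cnt_sum]
    push_cast
    apply Finset.sum_congr rfl
    intro r _
    split_ifs
    · rfl
    · simp
  rw [this, Finset.mul_sum]
  have h2 : ((∑ r, if p r then P r else 0 : MvPolynomial (Fin 2) ℚ) : MvPowerSeries (Fin 2) ℚ)
     = ∑ r, ((if p r then P r else 0 : MvPolynomial (Fin 2) ℚ) : MvPowerSeries (Fin 2) ℚ) :=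
    map_sum (MvPolynomial.coeToMvPowerSeries.ringHom (σ := Fin 2) (R := ℚ)) _ _
  rw [h2]
  apply Finset.sum_congr rfl
  intro r _
  split_ifs
  · exact hP r
  · simp

/-- The cut after `x` is crossed by an edge within `[0,n]`. -/
def Cr (S : Set ℤ) (n : ℕ) (D : Finset ℕ) (x : ℕ) : Prop :=
  ∃ i ∈ D, ∃ k ∈ D, i ≤ x ∧ x < k ∧ k ≤ n ∧ ((k : ℤ) - (i : ℤ)) ∈ S

theorem shadow_iff (S : Set ℤ)
    (hsym : ∀ s : ℤ, s ∈ S ↔ -s ∈ S)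
    (hclosed : ∀ s t : ℕ, (s : ℤ) ∉ S → (t : ℤ) ∉ S → ((s : ℤ) + (t : ℤ)) ∉ S)
    (D : Finset ℕ) (n : ℕ) (hn : ∀ d ∈ D, d ≤ n) (hnD : n ∈ D) :
    IsShadowF S D ↔ 0 ∈ D ∧ ∀ x < n, Cr S n D x := by
  have hsw : ∀ a b : ℤ, a - b ∈ S ↔ b - a ∈ S := fun a b => by
    rw [hsym, neg_sub]
  unfold IsShadowF
  refine and_congr_right fun h0 => ?_
  constructor
  · intro h x hx
    have hp := h 0 h0 n hnD
    have key : ∀ b, Relation.ReflTransGen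
      (fun a b : ℕ => a ∈ D ∧ b ∈ D ∧ (((a : ℤ) - (b : ℤ)) ∈ S ∨ ((b : ℤ) - (a : ℤ)) ∈ S)) 0 b →
        x < b → Cr S n D x := by
      intro b hb
      induction hb with
      | refl => intro h; omega
      | @tail b c hb hbc ih =>
        intro hc
        by_cases hxb : x < b
        · exact ih hxb
        · obtain ⟨h1, h2, h3⟩ := hbc
          refine ⟨b, h1, c, h2, by omega, hc, hn c h2, ?_⟩
          rcases h3 with h3 | h3
          · exact (hsw _ _).1 h3
          · exact h3
    exact key n hp hx
  · intro h
    set R := (fun a b : ℕ => a ∈ D ∧ b ∈ D ∧ (((a : ℤ) - (b : ℤ)) ∈ S ∨ ((b : ℤ) - (a : ℤ)) ∈ S))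
      with hR
    have hRs : Std.Symm R := ⟨fun a b h => ⟨h.2.1, h.1, h.2.2.symm⟩⟩
    have key : ∀ d, d ∈ D → Relation.ReflTransGen R 0 d := by
      intro d
      induction d using Nat.strong_induction_on with
      | _ d ih =>
        intro hd
        rcases Nat.eq_zero_or_pos d with rfl | hpos
        · exact .refl
        obtain ⟨i, hi, k, hk, hix, hxk, hkn, hS⟩ := h (d - 1) (by have := hn d hd; omega)
        have hi0 := ih i (by omega) hi
        by_cases hs : ((d : ℤ) - i) ∈ S
        · exact hi0.tail ⟨hi, hd, Or.inr hs⟩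
        · have hkd : ((k : ℤ) - d) ∈ S := by
            by_contra hkd
            refine hclosed (d - i) (k - d) ?_ ?_ ?_
            · rwa [Nat.cast_sub (by omega)]
            · rwa [Nat.cast_sub (by omega)]
            · rw [Nat.cast_sub (by omega), Nat.cast_sub (by omega)]
              convert hS using 1
              ring
          exact (hi0.tail ⟨hi, hk, Or.inr hS⟩).tail ⟨hk, hd, Or.inl hkd⟩
    intro i hi j hj
    exact (Std.Symm.symm _ _ (key i hi)).trans (key j hj)

/-- State components. -/
def cM (n : ℕ) (D : Finset ℕ) (j : ℕ) : Prop := j ≤ n ∧ n - j ∈ D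
def cT (n : ℕ) (D : Finset ℕ) (j : ℕ) : Prop := j ≤ n ∧ j ∈ D
def cB (S : Set ℤ) (n : ℕ) (D : Finset ℕ) (j : ℕ) : Prop := j ≤ n ∧ Cr S n D (n - j)
def cA (S : Set ℤ) (m n : ℕ) (D : Finset ℕ) : Prop := ∀ x, x + (m + 1) ≤ n → Cr S n D x

abbrev St (m : ℕ) : Type :=
  ((Fin (m + 1) → Prop) × (Fin (m + 1) → Prop)) × ((Fin (m + 1) → Prop) × (Fin (m + 1) → Prop)) × Prop

def stt (S : Set ℤ) (m n : ℕ) (D : Finset ℕ) : St m :=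
  ((fun j => cM n D j, fun j => cT n D j), (fun j => cB S n D j, fun j => j.1 ≤ n), cA S m n D)

theorem stt_eq_iff (S : Set ℤ) (m n : ℕ) (D : Finset ℕ) (n' : ℕ) (D' : Finset ℕ) :
    stt S m n D = stt S m n' D' ↔
      (∀ j ≤ m, cM n D j ↔ cM n' D' j) ∧ (∀ j ≤ m, cT n D j ↔ cT n' D' j) ∧
      (∀ j ≤ m, cB S n D j ↔ cB S n' D' j) ∧ (∀ j ≤ m, j ≤ n ↔ j ≤ n') ∧
      (cA S m n D ↔ cA S m n' D') := by
  simp only [stt, Prod.mk.injEq, funext_iff, Fin.forall_iff, Nat.lt_succ_iff, eq_iff_iff, and_assoc]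

theorem cr_succ (S : Set ℤ) (m : ℕ) (hmax : ∀ s ∈ S, s ≤ (m : ℤ)) (n : ℕ) (D : Finset ℕ) (j : ℕ)
    (hj : j ≤ n) :
    Cr S (n + 1) D (n - j) ↔ Cr S n D (n - j) ∨
      (n + 1 ∈ D ∧ ∃ i ≤ m, j ≤ i ∧ cM n D i ∧ ((i : ℤ) + 1) ∈ S) := by
  constructor
  · rintro ⟨i, hi, k, hk, h1, h2, h3, h4⟩
    by_cases hkn : k ≤ n
    · exact Or.inl ⟨i, hi, k, hk, h1, h2, hkn, h4⟩
    · obtain rfl : k = n + 1 := by omega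
      have := hmax _ h4
      refine Or.inr ⟨hk, n - i, by omega, by omega, ⟨by omega, ?_⟩, ?_⟩
      · rwa [Nat.sub_sub_self (by omega)]
      · convert h4 using 1
        rw [Nat.cast_sub (by omega)]; push_cast; ring
  · rintro (⟨i, hi, k, hk, h1, h2, h3, h4⟩ | ⟨hb, i, him, hji, ⟨hin, hiD⟩, hS⟩)
    · exact ⟨i, hi, k, hk, h1, h2, by omega, h4⟩
    · refine ⟨n - i, hiD, n + 1, hb, by omega, by omega, le_rfl, ?_⟩
      convert hS using 1
      rw [Nat.cast_sub (by omega)]; push_cast; ring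

theorem cA_succ (S : Set ℤ) (m : ℕ) (hmax : ∀ s ∈ S, s ≤ (m : ℤ)) (n : ℕ) (D : Finset ℕ) :
    cA S m (n + 1) D ↔ cA S m n D ∧ (m ≤ n → Cr S (n + 1) D (n - m)) := by
  constructor
  · intro h
    refine ⟨fun x hx => ?_, fun hmn => h _ (by omega)⟩
    obtain ⟨i, hi, k, hk, h1, h2, h3, h4⟩ := h x (by omega)
    have := hmax _ h4
    exact ⟨i, hi, k, hk, h1, h2, by omega, h4⟩
  · rintro ⟨h, h'⟩ x hx
    by_cases hxn : x + (m + 1) ≤ n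
    · obtain ⟨i, hi, k, hk, h1, h2, h3, h4⟩ := h x hxn
      exact ⟨i, hi, k, hk, h1, h2, by omega, h4⟩
    · have := h' (by omega)
      rwa [show n - m = x by omega] at this

theorem stt_step (S : Set ℤ) (m : ℕ) (hmax : ∀ s ∈ S, s ≤ (m : ℤ)) (n : ℕ) (D : Finset ℕ)
    (n' : ℕ) (D' : Finset ℕ) (h : stt S m n D = stt S m n' D')
    (hb : n + 1 ∈ D ↔ n' + 1 ∈ D') : stt S m (n + 1) D = stt S m (n' + 1) D' := by
  rw [stt_eq_iff] at h ⊢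
  obtain ⟨hM, hT, hB, hE, hA⟩ := h
  have hC : ∀ j ≤ m, (j ≤ n ∧ Cr S (n + 1) D (n - j)) ↔
      (j ≤ n' ∧ Cr S (n' + 1) D' (n' - j)) := by
    intro j hj
    have hX : (∃ i ≤ m, j ≤ i ∧ cM n D i ∧ ((i : ℤ) + 1) ∈ S) ↔
        (∃ i ≤ m, j ≤ i ∧ cM n' D' i ∧ ((i : ℤ) + 1) ∈ S) := by
      refine exists_congr fun i => and_congr_right fun hi => ?_
      rw [hM i hi]
    have h1 := hB j hj
    have h2 := hE j hj
    unfold cB at h1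
    constructor
    · rintro ⟨ha, hc⟩
      rw [cr_succ S m hmax n D j ha] at hc
      have ha' := h2.1 ha
      refine ⟨ha', ?_⟩
      rw [cr_succ S m hmax n' D' j ha']
      rw [hX, hb] at hc
      exact hc.imp_left fun h => (h1.1 ⟨ha, h⟩).2
    · rintro ⟨ha', hc⟩
      rw [cr_succ S m hmax n' D' j ha'] at hc
      have ha := h2.2 ha'
      refine ⟨ha, ?_⟩
      rw [cr_succ S m hmax n D j ha]
      rw [← hX, ← hb] at hc
      exact hc.imp_left fun h => (h1.2 ⟨ha', h⟩).2
  have hE' : ∀ j ≤ m, (j ≤ n + 1 ↔ j ≤ n' + 1) := by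
    intro j hj
    rcases j with _ | j
    · simp
    · have := hE j (by omega)
      omega
  refine ⟨?_, ?_, ?_, hE', ?_⟩
  · intro j hj
    rcases j with _ | j
    · simpa [cM] using hb
    · have := hM j (by omega)
      simpa [cM] using this
  · intro j hj
    have h1 := hT j hj
    have h2 := hE j hj
    have h3 := hE' j hj
    unfold cT at h1 ⊢
    by_cases hjn : j ≤ n
    · have : j ≤ n' := h2.1 hjn
      have e1 : j ≤ n + 1 := by omega
      have e2 : j ≤ n' + 1 := by omega
      simp only [hjn, this, e1, e2, true_and] at h1 ⊢
      exact h1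
    · by_cases hj1 : j = n + 1
      · obtain rfl : n' = n := by omega
        subst hj1
        simpa using hb
      · have e1 : ¬ j ≤ n + 1 := by omega
        have e2 : ¬ j ≤ n' + 1 := by omega
        simp [e1, e2]
  · intro j hj
    rcases j with _ | j
    · have : ∀ n D, ¬ cB S n D 0 := by
        rintro n D ⟨_, i, hi, k, hk, h1, h2, h3, h4⟩
        omega
      simp [this]
    · have := hC j (by omega)
      simpa [cB] using this
  · rw [cA_succ S m hmax, cA_succ S m hmax, hA]
    have h1 := hC m le_rfl
    have h2 := hE m le_rfl
    refine and_congr_right fun _ => ⟨fun h hm => (h1.1 ⟨h2.2 hm, h (h2.2 hm)⟩).2,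
      fun h hm => (h1.2 ⟨h2.1 hm, h (h2.1 hm)⟩).2⟩

theorem stt_loc (S : Set ℤ) (m n : ℕ) (D : Finset ℕ) :
    stt S m n (insert (n + 1) D) = stt S m n D := by
  have hm : ∀ i ≤ n, (i ∈ insert (n + 1) D ↔ i ∈ D) := by
    intro i hi
    simp only [Finset.mem_insert]
    constructor
    · rintro (h | h)
      · omega
      · exact h
    · exact Or.inr
  have hC : ∀ x, Cr S n (insert (n + 1) D) x ↔ Cr S n D x := by
    intro x
    constructor
    · rintro ⟨i, hi, k, hk, h1, h2, h3, h4⟩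
      exact ⟨i, (hm i (by omega)).1 hi, k, (hm k h3).1 hk, h1, h2, h3, h4⟩
    · rintro ⟨i, hi, k, hk, h1, h2, h3, h4⟩
      exact ⟨i, (hm i (by omega)).2 hi, k, (hm k h3).2 hk, h1, h2, h3, h4⟩
  rw [stt_eq_iff]
  refine ⟨?_, ?_, ?_, fun _ _ => Iff.rfl, ?_⟩
  · intro j _
    unfold cM
    rw [hm _ (by omega)]
  · intro j _
    exact and_congr_right fun h => hm j h
  · intro j _
    unfold cB
    rw [hC]
  · unfold cA
    simp only [hC]

/-- Accepting states. -/
def accS (m : ℕ) (U V : Finset ℕ) (q : St m) : Prop :=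
  q.1.1 0 ∧ q.2.2 ∧ (∀ j : Fin (m + 1), 1 ≤ j.1 → q.2.1.2 j → q.2.1.1 j) ∧
  (∀ j : Fin (m + 1), 1 ≤ j.1 → j.1 ≤ m - 1 → (q.1.2 j ↔ j.1 ∈ U)) ∧
  (∀ j : Fin (m + 1), 1 ≤ j.1 → j.1 ≤ m - 1 → (q.1.1 j ↔ j.1 ∈ V))

theorem accS_iff (S : Set ℤ)
    (hsym : ∀ s : ℤ, s ∈ S ↔ -s ∈ S)
    (hclosed : ∀ s t : ℕ, (s : ℤ) ∉ S → (t : ℤ) ∉ S → ((s : ℤ) + (t : ℤ)) ∉ S)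
    (m : ℕ) (U V : Finset ℕ) (hU : U ⊆ Finset.Icc 1 (m - 1)) (hV : V ⊆ Finset.Icc 1 (m - 1))
    (D : Finset ℕ) (k n : ℕ) :
    (D ∈ (Finset.range (n + 1)).powersetCard k ∧ 0 ∈ D ∧ accS m U V (stt S m n D)) ↔
     (IsShadowF S D ∧ startF m D = U ∧ endF m D = V ∧ D.card = k ∧ D.sup id = n) := by
  have hsup : (D ⊆ Finset.range (n + 1) ∧ 0 ∈ D ∧ n ∈ D) ↔ (0 ∈ D ∧ D.sup id = n) := by
    constructor
    · rintro ⟨h1, h0, h2⟩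
      refine ⟨h0, le_antisymm ?_ (Finset.le_sup (f := id) h2)⟩
      apply Finset.sup_le
      intro d hd
      have := Finset.mem_range.1 (h1 hd)
      simp; omega
    · rintro ⟨h0, rfl⟩
      refine ⟨?_, h0, ?_⟩
      · intro d hd
        have := Finset.le_sup (f := id) hd
        simp at this ⊢
        omega
      · obtain ⟨d, hd, he⟩ := Finset.exists_mem_eq_sup D ⟨0, h0⟩ id
        rw [he]; exact hd
  by_cases hgood : 0 ∈ D ∧ D.sup id = n
  swap
  · constructor
    · rintro ⟨h1, h0, h2⟩
      refine absurd (hsup.1 ⟨(Finset.mem_powersetCard.1 h1).1, h0, ?_⟩) hgood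
      have := h2.1
      simpa [stt, cM] using this
    · rintro ⟨h, _, _, _, h'⟩
      exact absurd ⟨h.1, h'⟩ hgood
  obtain ⟨hsub, h0, hnD⟩ := hsup.2 hgood
  have hn : ∀ d ∈ D, d ≤ n := fun d hd => by
    have := Finset.mem_range.1 (hsub hd); omega
  rw [shadow_iff S hsym hclosed D n hn hnD]
  have hstart : startF m D = U ↔ ∀ j ≤ m, 1 ≤ j → j ≤ m - 1 → (cT n D j ↔ j ∈ U) := by
    unfold startF cT
    constructor
    · rintro rfl j hj h1 h2
      simp only [Finset.mem_inter, Finset.mem_Icc]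
      constructor
      · rintro ⟨_, h⟩; exact ⟨h, h1, h2⟩
      · rintro ⟨h, _⟩; exact ⟨hn j h, h⟩
    · intro h
      ext j
      simp only [Finset.mem_inter, Finset.mem_Icc]
      constructor
      · rintro ⟨hD, h1, h2⟩
        exact (h j (by omega) h1 h2).1 ⟨hn j hD, hD⟩
      · intro hj
        have := Finset.mem_Icc.1 (hU hj)
        exact ⟨((h j (by omega) this.1 this.2).2 hj).2, this⟩
  have hmemE : ∀ j, j ∈ endF m D ↔ (1 ≤ j ∧ j ≤ m - 1) ∧ cM n D j := by
    intro j
    unfold endF cM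
    rw [hgood.2]
    simp only [Finset.mem_inter, Finset.mem_Icc, Finset.mem_image]
    constructor
    · rintro ⟨⟨d, hd, rfl⟩, h1⟩
      refine ⟨h1, by omega, ?_⟩
      rwa [Nat.sub_sub_self (hn d hd)]
    · rintro ⟨h1, h2, h3⟩
      exact ⟨⟨n - j, h3, Nat.sub_sub_self h2⟩, h1⟩
  have hend : endF m D = V ↔ ∀ j ≤ m, 1 ≤ j → j ≤ m - 1 → (cM n D j ↔ j ∈ V) := by
    constructor
    · rintro rfl j hj h1 h2
      rw [hmemE]
      tauto
    · intro h
      ext j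
      rw [hmemE]
      constructor
      · rintro ⟨⟨h1, h2⟩, h3⟩
        exact (h j (by omega) h1 h2).1 h3
      · intro hj
        have := Finset.mem_Icc.1 (hV hj)
        exact ⟨this, (h j (by omega) this.1 this.2).2 hj⟩
  have hcr : (∀ x < n, Cr S n D x) ↔ cA S m n D ∧ ∀ j ≤ m, 1 ≤ j → j ≤ n → cB S n D j := by
    constructor
    · intro h
      exact ⟨fun x hx => h x (by omega), fun j hj h1 h2 => ⟨h2, h _ (by omega)⟩⟩
    · rintro ⟨h1, h2⟩ x hx
      by_cases hxm : x + (m + 1) ≤ n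
      · exact h1 x hxm
      · have := (h2 (n - x) (by omega) (by omega) (by omega)).2
        rwa [Nat.sub_sub_self (by omega)] at this
  have hM0 : cM n D 0 := by simpa [cM] using hnD
  rw [hstart, hend, hcr]
  simp only [accS, stt, Fin.forall_iff, Nat.lt_succ_iff, Finset.mem_powersetCard]
  have := hgood.2
  have hM0' : cM n D ((0 : Fin (m + 1)) : ℕ) := hM0
  tauto

/-- Lemma 5.14. Let `S ⊂ ℤ` be finite nonempty with `S = -S` and
`s+t ∉ S` for all `s,t ∈ ℕ∖S`, `m = max S`. For all `U,V ⊆ [m-1]`, the formal power series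
`D_S^{U,V}(X,Y)` is rational: there are polynomials `P,Q ∈ ℚ[X,Y]` with `Q(0,0) ≠ 0` and
`Q·D_S^{U,V} = P` in `ℚ[[X,Y]]`. -/
theorem DSeries_rational (S : Set ℤ) (hfin : S.Finite) (hne : S.Nonempty)
    (hsym : ∀ s : ℤ, s ∈ S ↔ -s ∈ S)
    (hclosed : ∀ s t : ℕ, (s : ℤ) ∉ S → (t : ℤ) ∉ S → ((s : ℤ) + (t : ℤ)) ∉ S)
    (m : ℕ) (hmS : (m : ℤ) ∈ S) (hmax : ∀ s ∈ S, s ≤ (m : ℤ))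
    (U V : Finset ℕ) (hU : U ⊆ Finset.Icc 1 (m - 1)) (hV : V ⊆ Finset.Icc 1 (m - 1)) :
    ∃ P Q : MvPolynomial (Fin 2) ℚ, MvPolynomial.coeff 0 Q ≠ 0 ∧
      (Q : MvPowerSeries (Fin 2) ℚ) * DSeries S m U V = (P : MvPowerSeries (Fin 2) ℚ) := by
  classical
  haveI : Fintype (St m) := Fintype.ofFinite _
  let δ : St m → Bool → St m := fun q b =>
    if h : ∃ nD : ℕ × Finset ℕ, stt S m nD.1 nD.2 = q ∧ (decide (nD.1 + 1 ∈ nD.2) = b) then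
      stt S m (h.choose.1 + 1) h.choose.2 else q
  have hst : ∀ n D, stt S m (n + 1) D = δ (stt S m n D) (decide (n + 1 ∈ D)) := by
    intro n D
    have h : ∃ nD : ℕ × Finset ℕ, stt S m nD.1 nD.2 = stt S m n D ∧
        (decide (nD.1 + 1 ∈ nD.2) = decide (n + 1 ∈ D)) := ⟨(n, D), rfl, rfl⟩
    simp only [δ, dif_pos h]
    refine (stt_step S m hmax _ _ _ _ h.choose_spec.1 ?_).symm
    have := h.choose_spec.2
    simpa using this
  obtain ⟨P, Q, hQ, hP⟩ := transfer_rational (stt S m) (accS m U V) δ hst (stt_loc S m)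
  refine ⟨P, Q, hQ, ?_⟩
  rw [← hP]
  congr 1
  funext e
  unfold DSeries cntSeries cnt
  norm_cast
  apply Nat.subtype_card
  intro D
  rw [Finset.mem_filter]
  exact accS_iff S hsym hclosed m U V hU hV D (e 0) (e 1)

end Braid
end

section
/- Let m,n be positive integers, let A ⊆ A_m^n be an arrangement, and let L ∈ L(A) with d = dim(L). Define ψ_L : L → ℝ^d by ψ_L(x_1,…,x_n) = (x_{a_1},…,x_{a_d}), where for each k ∈ [d], a_k is the ≺_L-minimal element of the block B_k. Then ψ_L is an affine bijection from L onto ℝ^d, and the map H ∩ L ↦ ψ_L(H ∩ L) is a bijection from the restricted arrangement A_L = {H ∩ L : H ∈ A, ∅ ≠ H ∩ L ≠ L} onto the set of hyperplanes of Ã_L; in particular the arrangements A_L and Ã_L are isomorphic. Moreover Ã_L ⊆ A_{mn}^d, i.e., every hyperplane of Ã_L is of the form {y ∈ ℝ^d : y_k − y_ℓ = s} with |s| ≤ mn. -/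
open scoped BigOperators Classical

namespace Braid

/-- The intersection lattice `L(A)`: nonempty intersections of subfamilies of `A`
(including `ℝ^n` as the empty intersection). -/
def latt (n : ℕ) (A : Set (Set (Fin n → ℝ))) : Set (Set (Fin n → ℝ)) :=
  {L | L.Nonempty ∧ ∃ B ⊆ A, L = ⋂₀ B}

/-- `i ∼_L j`: `L` is contained in a hyperplane `{x_i - x_j = s}` for some `s ∈ ℤ`. -/
def simL (n : ℕ) (L : Set (Fin n → ℝ)) (i j : Fin n) : Prop :=
  ∃ s : ℤ, L ⊆ hyp n i j (s : ℝ)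

/-- The set `blocks(L)` of equivalence classes of `∼_L`. -/
def blocksL (n : ℕ) (L : Set (Fin n → ℝ)) : Set (Set (Fin n)) :=
  {C | ∃ i, C = {j | simL n L i j}}

/-- `i ≼_L j` (within a block of `L`): `x_i < x_j` on `L`, or `x_i = x_j` on `L`
and `i ≤ j`. -/
def precLE (n : ℕ) (L : Set (Fin n → ℝ)) (i j : Fin n) : Prop :=
  (∀ x ∈ L, x i < x j) ∨ ((∀ x ∈ L, x i = x j) ∧ i ≤ j)

/-- The arrangement `Ã_L ⊆ ℝ^d` (given the enumeration `B` of the blocks of `L` and the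
function `δ = δ_L`). -/
def Atilde (n d : ℕ) (A : Set (Set (Fin n → ℝ))) (B : Fin d → Set (Fin n))
    (δ : Fin n → ℕ) : Set (Set (Fin d → ℝ)) :=
  {H | ∃ k l : Fin d, k ≠ l ∧ ∃ i ∈ B k, ∃ j ∈ B l, ∃ s : ℤ,
    hyp n i j (s : ℝ) ∈ A ∧ H = hyp d k l ((s : ℝ) - (δ i : ℝ) + (δ j : ℝ))}

theorem hyp_eq_natAbs {n m : ℕ} {i j i' j' : Fin n} {s s' : ℤ} (hij : i ≠ j) (hij' : i' ≠ j')
    (h : hyp n i j (s : ℝ) = hyp n i' j' (s' : ℝ)) (hs : s'.natAbs ≤ m) : s.natAbs ≤ m := by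
  have key : ∀ x : Fin n → ℝ, x i - x j = s → x i' - x j' = s' := by
    intro x hx
    have : x ∈ hyp n i j (s : ℝ) := hx
    rw [h] at this
    exact this
  have k0 := key (fun v => if v = i then (s : ℝ) else 0) (by simp [hij.symm])
  have k1 := key (fun v => (if v = i then (s : ℝ) else 0) + (if v = i ∨ v = j then 1 else 0))
    (by simp [hij.symm])
  by_cases hi : i' = i
  · subst hi
    by_cases hj : j' = j
    · subst hj
      simp [hij.symm] at k0
      have : s = s' := by exact_mod_cast k0
      omega
    · simp [hij'.symm, hj] at k0 k1
      subst k0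
      linarith
  · by_cases hi2 : i' = j
    · subst hi2
      by_cases hj : j' = i
      · subst hj
        simp [hij'] at k0
        have : -s = s' := by exact_mod_cast k0
        omega
      · simp [hij'.symm, hj, hij.symm] at k0 k1
        linarith
    · have k2 := key (fun v => (if v = i then (s : ℝ) else 0) + (if v = i' then 1 else 0))
        (by simp [hij.symm, Ne.symm hi, Ne.symm hi2])
      simp [hi, hij'.symm] at k0 k2
      linarith

theorem diff_bound {n m : ℕ} {A C : Set (Set (Fin n → ℝ))} (hA : A ⊆ catArr m n) (hC : C ⊆ A)
    {x : Fin n → ℝ} (hx : x ∈ ⋂₀ C) {i j : Fin n} {c : ℝ}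
    (hc : ∀ x ∈ ⋂₀ C, x i - x j = c) : |c| ≤ (m : ℝ) * ((n : ℝ) - 1) := by
  let G : SimpleGraph (Fin n) :=
    { Adj := fun u v => u ≠ v ∧ |x u - x v| ≤ m ∧ (∃ s : ℝ, hyp n u v s ∈ C ∨ hyp n v u s ∈ C)
      symm := ⟨by
        rintro u v ⟨h1, h2, s, h3⟩
        exact ⟨h1.symm, by rwa [abs_sub_comm], s, h3.symm⟩⟩
      loopless := ⟨fun u h => h.1 rfl⟩ }
  have hreach : G.Reachable i j := by
    by_contra hnr
    let y : Fin n → ℝ := fun v => x v + (if G.Reachable i v then 1 else 0)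
    have hy : y ∈ ⋂₀ C := by
      intro H hH
      obtain ⟨u, v, s, huv, hs, rfl⟩ := hA (hC hH)
      have hxH : x u - x v = s := hx _ hH
      have hadj : G.Adj u v := by
        refine ⟨huv.ne, ?_, s, Or.inl hH⟩
        rw [hxH]
        have hs' : s.natAbs ≤ m := hs
        have : |s| ≤ (m : ℤ) := by rw [Int.abs_eq_natAbs]; exact_mod_cast hs'
        exact_mod_cast this
      have hiff : G.Reachable i u ↔ G.Reachable i v :=
        ⟨fun h => h.trans hadj.reachable, fun h => h.trans hadj.symm.reachable⟩
      change y u - y v = s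
      simp only [y, hiff]
      linarith
    have h1 := hc _ hy
    have h2 := hc _ hx
    simp only [y, hnr, SimpleGraph.Reachable.refl, if_true, if_false] at h1
    linarith
  obtain ⟨p, hp⟩ := hreach.exists_isPath
  have hlen := hp.length_lt
  rw [Fintype.card_fin] at hlen
  have hw : ∀ (u v : Fin n) (p : G.Walk u v), |x u - x v| ≤ m * (p.length : ℝ) := by
    intro u v p
    induction p with
    | nil => simp
    | @cons u v w h p ih =>
      have h1 := h.2.1
      have h2 := abs_sub_le (x u) (x v) (x w)
      simp only [SimpleGraph.Walk.length_cons]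
      push_cast
      linarith
  rw [← hc x hx]
  refine (hw i j p).trans ?_
  have : (p.length : ℝ) + 1 ≤ n := by exact_mod_cast hlen
  gcongr
  linarith

/-- Lemma 6.1. For `A ⊆ A_m^n` and `L ∈ L(A)` of dimension `d`, with
`{B_1,…,B_d}` the blocks of `L` (ordered by their minima), `a_k` the `≼_L`-minimal element
of `B_k` and `δ = δ_L`: the map `ψ_L(x) = (x_{a_1},…,x_{a_d})` is an affine bijection from
`L` onto `ℝ^d`, the map `H ∩ L ↦ ψ_L(H ∩ L)` is a bijection from the restriction `A_L` onto
the set of hyperplanes of `Ã_L`; moreover every hyperplane of `Ã_L` has the form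
`{y_k - y_l = s}` with `|s| ≤ mn`. -/
theorem restriction_isomorphism (m n : ℕ) (hm : 0 < m) (hn : 0 < n)
    (A : Set (Set (Fin n → ℝ))) (hA : A ⊆ catArr m n)
    (L : Set (Fin n → ℝ)) (hL : L ∈ latt n A)
    (d : ℕ) (hd : faceDim n L = d)
    (B : Fin d → Set (Fin n))
    (hBmem : ∀ k, B k ∈ blocksL n L)
    (hBall : ∀ C ∈ blocksL n L, ∃! k, B k = C)
    (hBmono : StrictMono fun k => sInf {c : ℕ | ∃ v ∈ B k, (v : ℕ) = c})
    (a : Fin d → Fin n) (ha : ∀ k, a k ∈ B k ∧ ∀ j ∈ B k, precLE n L (a k) j)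
    (δ : Fin n → ℕ) (hδ : ∀ k, ∀ i ∈ B k, ∀ x ∈ L, x i - x (a k) = (δ i : ℝ)) :
    (∃ ψa : (Fin n → ℝ) →ᵃ[ℝ] (Fin d → ℝ),
      ∀ x : Fin n → ℝ, ψa x = fun k => x (a k)) ∧
    Set.BijOn (fun (x : Fin n → ℝ) (k : Fin d) => x (a k)) L Set.univ ∧
    Set.BijOn (fun K => (fun (x : Fin n → ℝ) (k : Fin d) => x (a k)) '' K)
      {K | ∃ H ∈ A, K = H ∩ L ∧ (H ∩ L).Nonempty ∧ H ∩ L ≠ L}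
      (Atilde n d A B δ) ∧
    ∀ H ∈ Atilde n d A B δ, ∃ (k l : Fin d) (s : ℤ), k ≠ l ∧ s.natAbs ≤ m * n ∧
      H = hyp d k l (s : ℝ) := by
  obtain ⟨hne, C, hC, rfl⟩ := hL
  obtain ⟨x0, hx0⟩ := hne
  set L := ⋂₀ C with hLdef
  have hself : ∀ i, simL n L i i := fun i => ⟨0, fun x _ => by simp [hyp]⟩
  have htr : ∀ i j k, simL n L i j → simL n L i k → simL n L j k := by
    rintro i j k ⟨s, hs⟩ ⟨t, ht⟩
    refine ⟨t - s, fun x hx => ?_⟩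
    have h1 : x i - x j = s := hs hx
    have h2 : x i - x k = t := ht hx
    change x j - x k = _
    push_cast
    linarith
  have hex : ∀ i, ∃ k, B k = {j | simL n L i j} := fun i => (hBall _ ⟨i, rfl⟩).exists
  choose κ hκ using hex
  have hκmem : ∀ i, i ∈ B (κ i) := fun i => by rw [hκ]; exact hself i
  have hκeq : ∀ i j, simL n L i j → κ i = κ j := by
    intro i j hij
    refine (hBall _ ⟨j, rfl⟩).unique ?_ (hκ j)
    rw [hκ]
    ext v
    exact ⟨fun h => htr _ _ _ hij h, fun h => htr _ _ _ (htr _ _ _ hij (hself i)) h⟩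
  have hmem : ∀ k i, i ∈ B k → κ i = k := by
    intro k i hi
    obtain ⟨v, hv⟩ := hBmem k
    have h1 : κ v = k := (hBall _ ⟨v, rfl⟩).unique (hκ v) hv
    rw [hv] at hi
    rw [← h1]
    exact (hκeq _ _ hi).symm
  have hκa : ∀ k, κ (a k) = k := fun k => hmem _ _ (ha k).1
  have hδa : ∀ k, (δ (a k) : ℝ) = 0 := fun k => by
    rw [← hδ k (a k) (ha k).1 x0 hx0, sub_self]
  have hLiff : ∀ x, x ∈ L ↔ ∀ i, x i = x (a (κ i)) + δ i := by
    intro x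
    constructor
    · intro hx i
      linarith [hδ _ i (hκmem i) x hx]
    · intro hx H hH
      obtain ⟨u, v, s, huv, hs, rfl⟩ := hA (hC hH)
      have hLH : L ⊆ hyp n u v s := fun z hz => hz _ hH
      have e : κ u = κ v := hκeq _ _ ⟨s, hLH⟩
      have h0 : x0 u - x0 v = s := hLH hx0
      have h1 := hδ _ u (hκmem u) x0 hx0
      have h2 := hδ _ v (hκmem v) x0 hx0
      have h3 := hx u
      have h4 := hx v
      rw [e] at h1 h3
      change x u - x v = s
      linarith
  have hinj : Set.InjOn (fun (x : Fin n → ℝ) (k : Fin d) => x (a k)) L := by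
    intro x hx y hy hxy
    funext i
    rw [(hLiff x).1 hx i, (hLiff y).1 hy i]
    have : x (a (κ i)) = y (a (κ i)) := congrFun hxy (κ i)
    rw [this]
  have hsec : ∀ y : Fin d → ℝ, (fun i => y (κ i) + δ i) ∈ L ∧
      (fun k => (fun i => y (κ i) + (δ i : ℝ)) (a k)) = y := by
    intro y
    refine ⟨(hLiff _).2 fun i => ?_, ?_⟩
    · simp [hκa, hδa]
    · funext k
      simp [hκa, hδa]
  have him : ∀ i j (s : ℝ), (fun (x : Fin n → ℝ) (k : Fin d) => x (a k)) '' (hyp n i j s ∩ L)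
      = hyp d (κ i) (κ j) (s - δ i + δ j) := by
    intro i j s
    ext y
    constructor
    · rintro ⟨x, ⟨hx1, hx2⟩, rfl⟩
      have h1 := (hLiff x).1 hx2 i
      have h2 := (hLiff x).1 hx2 j
      have h3 : x i - x j = s := hx1
      change x (a (κ i)) - x (a (κ j)) = _
      linarith
    · intro hy
      refine ⟨_, ⟨?_, (hsec y).1⟩, (hsec y).2⟩
      have h3 : y (κ i) - y (κ j) = s - δ i + δ j := hy
      change y (κ i) + δ i - (y (κ j) + δ j) = s
      linarith
  refine ⟨⟨(LinearMap.funLeft ℝ ℝ a).toAffineMap, fun x => rfl⟩,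
    ⟨fun _ _ => trivial, hinj, fun y _ => ⟨_, (hsec y).1, (hsec y).2⟩⟩, ⟨?_, ?_, ?_⟩, ?_⟩
  · rintro K ⟨H, hH, rfl, ⟨z, hz1, hz2⟩, hneL⟩
    obtain ⟨i, j, s, hij, hs, rfl⟩ := hA hH
    refine ⟨κ i, κ j, ?_, i, hκmem i, j, hκmem j, s, hH, him _ _ _⟩
    intro e
    apply hneL
    refine Set.inter_eq_right.2 fun x hx => ?_
    have h1 := (hLiff x).1 hx i
    have h2 := (hLiff x).1 hx j
    have h3 := (hLiff z).1 hz2 i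
    have h4 := (hLiff z).1 hz2 j
    have h5 : z i - z j = s := hz1
    rw [e] at h1 h3
    change x i - x j = s
    linarith
  · rintro K ⟨H, hH, rfl, -, -⟩ K' ⟨H', hH', rfl, -, -⟩ h
    exact (hinj.image_eq_image_iff Set.inter_subset_right Set.inter_subset_right).1 h
  · rintro _ ⟨k, l, hkl, i, hi, j, hj, s, hH, rfl⟩
    have hi' := hmem _ _ hi
    have hj' := hmem _ _ hj
    subst hi' hj'
    refine ⟨hyp n i j s ∩ L, ⟨_, hH, rfl, ?_, ?_⟩, him _ _ _⟩
    · rw [← Set.image_nonempty (f := fun (x : Fin n → ℝ) (k : Fin d) => x (a k)), him]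
      exact ⟨fun k => if k = κ i then (s : ℝ) - δ i + δ j else 0, by simp [hyp, hkl.symm]⟩
    · intro e
      have h1 := him i j s
      rw [e] at h1
      have h2 := hsec (fun k => if k = κ i then (s : ℝ) - δ i + δ j + 1 else 0)
      have h3 : (fun k => if k = κ i then (s : ℝ) - δ i + δ j + 1 else 0)
          ∈ hyp d (κ i) (κ j) (s - δ i + δ j) := by
        rw [← h1]
        exact ⟨_, h2.1, h2.2⟩
      simp [hyp, hkl.symm] at h3
  · rintro _ ⟨k, l, hkl, i, hi, j, hj, s, hH, rfl⟩
    refine ⟨k, l, s - δ i + δ j, hkl, ?_, by push_cast; rfl⟩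
    have hij : i ≠ j := by
      rintro rfl
      exact hkl ((hmem _ _ hi).symm.trans (hmem _ _ hj))
    have hsm : s.natAbs ≤ m := by
      obtain ⟨i', j', s', hij', hs', e⟩ := hA hH
      exact hyp_eq_natAbs hij hij'.ne e hs'
    have b1 := diff_bound hA hC hx0 (hδ k i hi)
    have b2 := diff_bound hA hC hx0 (hδ l j hj)
    rw [Nat.abs_cast] at b1 b2
    have c1 : (δ i : ℤ) ≤ m * (n - 1) := by exact_mod_cast b1
    have c2 : (δ j : ℤ) ≤ m * (n - 1) := by exact_mod_cast b2
    rw [mul_sub, mul_one] at c1 c2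
    have c3 : ((m * n : ℕ) : ℤ) = m * n := by push_cast; rfl
    generalize m * n = q at *
    generalize (m : ℤ) * n = r at *
    omega

end Braid
end
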